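/- There is a universal constant c > 0 with the following property. Let n ≥ 3, let K ⊆ ℝⁿ be a convex body with 0 in its interior, and let δ > 0. If for every pair of 2-dimensional linear subspaces E, F ⊆ ℝⁿ one has d_BM(K ∩ E, K ∩ F) < 1 + δ, then for every 2-dimensional linear subspace E ⊆ ℝⁿ one has d_BM(K ∩ E, B²) < 1 + c·δ^{1/3}, where B² is the closed Euclidean unit disc. -/

import Mathlib

open Set Metric Pointwise

/-- `dBMlt K L lam` expresses that the (affine) Banach–Mazur distance between the
convex bodies `K ⊆ V` and `L ⊆ W` is `< lam`: there exist an invertible affine map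
`T : W → V` and a vector `z ∈ V` with `K ⊆ T(L) ⊆ lam • K + z`. -/
def dBMlt {V W : Type*} [AddCommGroup V] [Module ℝ V] [AddCommGroup W] [Module ℝ W]
    (K : Set V) (L : Set W) (lam : ℝ) : Prop :=
  ∃ (T : W ≃ᵃ[ℝ] V) (z : V), K ⊆ T '' L ∧ T '' L ⊆ lam • K + {z}

/-- A continuous function on the plane that winds a nonzero number of times along the unit circle
vanishes somewhere. -/
theorem exists_zero_of_winding {f : ℂ → ℂ} (hf : Continuous f) {k : ℤ} (hk : k ≠ 0)
    (hw : ∀ θ : ℝ, f (Complex.exp (θ * Complex.I)) = Complex.exp (k * θ * Complex.I) * f 1) :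
    ∃ w, f w = 0 := by
  by_contra! h
  have : ContractibleSpace (univ : Set ℂ) := convex_univ.contractibleSpace univ_nonempty
  obtain ⟨L, hLc, hL⟩ := Complex.exists_continuousOn_eqOn_exp_comp (X := ℂ) (U := univ) (g := f)
    (SimplyConnectedSpace.ofContractible _) isOpen_univ hf.continuousOn (by
      rintro ⟨x, -, hx⟩; exact h x hx)
  replace hLc : Continuous L := continuousOn_univ.1 hLc
  have hLe : ∀ w, Complex.exp (L w) = f w := fun w => hL (mem_univ w)
  let g : ℝ → ℂ := fun θ => L (Complex.exp (θ * Complex.I)) - k * θ * Complex.I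
  have hg : Continuous g := by fun_prop
  have hge : ∀ θ, Complex.exp (g θ) = f 1 := by
    intro θ
    simp only [g]
    rw [Complex.exp_sub, hLe, hw, mul_div_assoc, mul_comm, div_mul_cancel₀ _ (Complex.exp_ne_zero _)]
  have key := Complex.isCoveringMap_exp.const_of_comp hg
    (fun a b => Subtype.ext ((hge a).trans (hge b).symm)) (2 * Real.pi) 0
  have h2 : Complex.exp (((2 * Real.pi : ℝ) : ℂ) * Complex.I) = 1 := by
    push_cast; exact Complex.exp_two_pi_mul_I
  simp only [g, h2] at key
  simp [hk, Real.pi_ne_zero] at key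
section Fourier

open Complex Real ComplexConjugate intervalIntegral

/-- The integral of a function over the unit circle. -/
noncomputable def circleMean (h : ℂ → ℝ) : ℝ :=
  ∫ t in (0 : ℝ)..2 * π, h (cexp (t * I))

/-- The (unnormalised) Fourier coefficients of the restriction of a function to the unit circle. -/
noncomputable def circleCoeff (h : ℂ → ℝ) (m : ℤ) : ℂ :=
  ∫ t in (0 : ℝ)..2 * π, (h (cexp (t * I)) : ℂ) * cexp (m * t * I)

theorem circleCoeff_zero (h : ℂ → ℝ) : circleCoeff h 0 = circleMean h := by
  simp [circleCoeff, circleMean, intervalIntegral.integral_ofReal]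

theorem circleCoeff_sub {f g : ℂ → ℝ} (hf : Continuous f) (hg : Continuous g) (m : ℤ) :
    circleCoeff (fun ξ => f ξ - g ξ) m = circleCoeff f m - circleCoeff g m := by
  unfold circleCoeff
  rw [← intervalIntegral.integral_sub]
  · congr 1; ext t; push_cast; ring
  · exact Continuous.intervalIntegrable (by fun_prop) _ _
  · exact Continuous.intervalIntegrable (by fun_prop) _ _

theorem circleCoeff_add {f g : ℂ → ℝ} (hf : Continuous f) (hg : Continuous g) (m : ℤ) :
    circleCoeff (fun ξ => f ξ + g ξ) m = circleCoeff f m + circleCoeff g m := by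
  unfold circleCoeff
  rw [← intervalIntegral.integral_add]
  · congr 1; ext t; push_cast; ring
  · exact Continuous.intervalIntegrable (by fun_prop) _ _
  · exact Continuous.intervalIntegrable (by fun_prop) _ _

theorem circleCoeff_const_mul (c : ℝ) (f : ℂ → ℝ) (m : ℤ) :
    circleCoeff (fun ξ => c * f ξ) m = c * circleCoeff f m := by
  unfold circleCoeff
  rw [← intervalIntegral.integral_const_mul]
  congr 1; ext t; push_cast; ring

theorem integral_cexp_int_mul (m : ℤ) :
    ∫ t in (0 : ℝ)..2 * π, cexp (m * t * I) = if m = 0 then 2 * π else 0 := by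
  split_ifs with h
  · simp [h]
  · have h1 : (m : ℂ) * I ≠ 0 := by simp [h]
    have := integral_exp_mul_complex (a := 0) (b := 2 * π) h1
    have h2 : ∀ t : ℝ, cexp (m * t * I) = cexp (m * I * t) := fun t => by congr 1; ring
    simp_rw [h2]
    rw [this]
    have h3 : cexp (m * I * ((2 * π : ℝ) : ℂ)) = 1 := by
      rw [Complex.exp_eq_one_iff]; exact ⟨m, by push_cast; ring⟩
    rw [h3]; simp

theorem circleCoeff_const (c : ℝ) (m : ℤ) :
    circleCoeff (fun _ => c) m = if m = 0 then 2 * π * c else 0 := by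
  unfold circleCoeff
  rw [intervalIntegral.integral_const_mul, integral_cexp_int_mul]
  split_ifs <;> simp [mul_comm]

theorem ofReal_inner_cexp (v : ℂ) (t : ℝ) :
    ((inner ℝ v (cexp (t * I)) : ℝ) : ℂ) =
      (conj v * cexp ((1 : ℤ) * t * I) + v * cexp ((-1 : ℤ) * t * I)) / 2 := by
  have h1 : conj (cexp (t * I)) = cexp ((-1 : ℤ) * t * I) := by
    simp [← Complex.exp_conj]
  rw [Complex.inner, Complex.re_eq_add_conj, map_mul, Complex.conj_conj, h1]
  simp only [Int.cast_one, one_mul]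
  ring

theorem circleCoeff_inner (v : ℂ) (m : ℤ) :
    circleCoeff (fun ξ => inner ℝ v ξ) m =
      (if m = -1 then π * conj v else 0) + if m = 1 then π * v else 0 := by
  unfold circleCoeff
  have h1 : ∀ t : ℝ, ((inner ℝ v (cexp (t * I)) : ℝ) : ℂ) * cexp (m * t * I) =
      conj v / 2 * cexp ((m + 1 : ℤ) * t * I) + v / 2 * cexp ((m - 1 : ℤ) * t * I) := by
    intro t
    rw [ofReal_inner_cexp]
    have e1 : cexp ((m + 1 : ℤ) * t * I) = cexp ((1 : ℤ) * t * I) * cexp (m * t * I) := by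
      rw [← Complex.exp_add]; congr 1; push_cast; ring
    have e2 : cexp ((m - 1 : ℤ) * t * I) = cexp ((-1 : ℤ) * t * I) * cexp (m * t * I) := by
      rw [← Complex.exp_add]; congr 1; push_cast; ring
    rw [e1, e2]; ring
  simp_rw [h1]
  rw [intervalIntegral.integral_add, intervalIntegral.integral_const_mul,
    intervalIntegral.integral_const_mul, integral_cexp_int_mul, integral_cexp_int_mul]
  · have a1 : (m + 1 = 0) ↔ m = -1 := by omega
    have a2 : (m - 1 = 0) ↔ m = 1 := by omega
    simp only [a1, a2]
    split_ifs <;> push_cast <;> ring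
  · exact Continuous.intervalIntegrable (by fun_prop) _ _
  · exact Continuous.intervalIntegrable (by fun_prop) _ _

theorem circleCoeff_neg (h : ℂ → ℝ) (m : ℤ) : circleCoeff h (-m) = conj (circleCoeff h m) := by
  unfold circleCoeff
  rw [intervalIntegral.integral_of_le (by positivity), intervalIntegral.integral_of_le (by positivity),
    ← integral_conj]
  congr 1; ext t
  simp [← Complex.exp_conj]

theorem circleCoeff_comp_mul (h : ℂ → ℝ) (m : ℤ) (θ : ℝ) :
    circleCoeff (fun ξ => h (cexp (θ * I) * ξ)) m = cexp (-m * θ * I) * circleCoeff h m := by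
  unfold circleCoeff
  have hp : Function.Periodic (fun t : ℝ => (h (cexp (t * I)) : ℂ) * cexp (m * t * I)) (2 * π) := by
    intro t
    have e1 : cexp (((t + 2 * π : ℝ) : ℂ) * I) = cexp (t * I) := by
      rw [Complex.exp_eq_exp_iff_exists_int]; exact ⟨1, by push_cast; ring⟩
    have e2 : cexp (m * ((t + 2 * π : ℝ) : ℂ) * I) = cexp (m * t * I) := by
      rw [Complex.exp_eq_exp_iff_exists_int]; exact ⟨m, by push_cast; ring⟩
    simp only [e1, e2]
  have h1 : ∀ t : ℝ, (h (cexp (θ * I) * cexp (t * I)) : ℂ) * cexp (m * t * I) =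
      cexp (-m * θ * I) * ((h (cexp ((t + θ : ℝ) * I)) : ℂ) * cexp (m * (t + θ : ℝ) * I)) := by
    intro t
    have e1 : cexp (θ * I) * cexp (t * I) = cexp ((t + θ : ℝ) * I) := by
      rw [← Complex.exp_add]; congr 1; push_cast; ring
    have e2 : cexp (m * t * I) = cexp (-m * θ * I) * cexp (m * (t + θ : ℝ) * I) := by
      rw [← Complex.exp_add]; congr 1; push_cast; ring
    rw [e1, e2]; ring
  simp_rw [h1]
  rw [intervalIntegral.integral_const_mul]
  congr 1
  have := intervalIntegral.integral_comp_add_right (a := 0) (b := 2 * π)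
    (fun t : ℝ => (h (cexp (t * I)) : ℂ) * cexp (m * t * I)) θ
  rw [this, zero_add, add_comm (2 * π) θ, hp.intervalIntegral_add_eq θ 0, zero_add]

theorem circleCoeff_comp_conj (h : ℂ → ℝ) (m : ℤ) :
    circleCoeff (fun ξ => h (conj ξ)) m = circleCoeff h (-m) := by
  unfold circleCoeff
  have hp : Function.Periodic
      (fun t : ℝ => (h (cexp (t * I)) : ℂ) * cexp ((-m : ℤ) * t * I)) (2 * π) := by
    intro t
    have e1 : cexp (((t + 2 * π : ℝ) : ℂ) * I) = cexp (t * I) := by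
      rw [Complex.exp_eq_exp_iff_exists_int]; exact ⟨1, by push_cast; ring⟩
    have e2 : cexp ((-m : ℤ) * ((t + 2 * π : ℝ) : ℂ) * I) = cexp ((-m : ℤ) * t * I) := by
      rw [Complex.exp_eq_exp_iff_exists_int]; exact ⟨-m, by push_cast; ring⟩
    simp only [e1, e2]
  have h1 : ∀ t : ℝ, (h (conj (cexp (t * I))) : ℂ) * cexp (m * t * I) =
      (h (cexp ((-t : ℝ) * I)) : ℂ) * cexp ((-m : ℤ) * (-t : ℝ) * I) := by
    intro t
    have e1 : conj (cexp (t * I)) = cexp ((-t : ℝ) * I) := by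
      simp [← Complex.exp_conj]
    rw [e1]; congr 2; push_cast; ring
  simp_rw [h1]
  have := intervalIntegral.integral_comp_neg (a := 0) (b := 2 * π)
    (fun t : ℝ => (h (cexp (t * I)) : ℂ) * cexp ((-m : ℤ) * t * I))
  rw [this]
  have h3 := hp.intervalIntegral_add_eq (-(2 * π)) 0
  rw [zero_add, neg_add_cancel] at h3
  rw [neg_zero, h3]

theorem norm_circleCoeff_comp_mul {u : ℂ} (hu : ‖u‖ = 1) (h : ℂ → ℝ) (m : ℤ) :
    ‖circleCoeff (fun ξ => h (u * ξ)) m‖ = ‖circleCoeff h m‖ := by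
  obtain ⟨θ, rfl⟩ : ∃ θ : ℝ, cexp (θ * I) = u := by
    refine ⟨u.arg, ?_⟩
    have := Complex.norm_mul_exp_arg_mul_I u
    rwa [hu, ofReal_one, one_mul] at this
  rw [circleCoeff_comp_mul, norm_mul]
  have : cexp (-m * θ * I) = cexp ((-m * θ : ℝ) * I) := by push_cast; rfl
  rw [this, Complex.norm_exp_ofReal_mul_I, one_mul]

theorem norm_circleCoeff_comp_mul_conj {u : ℂ} (hu : ‖u‖ = 1) (h : ℂ → ℝ) (m : ℤ) :
    ‖circleCoeff (fun ξ => h (u * conj ξ)) m‖ = ‖circleCoeff h m‖ := by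
  rw [circleCoeff_comp_conj (fun ξ => h (u * ξ)), norm_circleCoeff_comp_mul hu, circleCoeff_neg,
    RCLike.norm_conj]

theorem norm_circleCoeff_le {f g : ℂ → ℝ} (hg : Continuous g)
    (hfg : ∀ ξ, ‖ξ‖ = 1 → |f ξ| ≤ g ξ) (m : ℤ) : ‖circleCoeff f m‖ ≤ circleMean g := by
  unfold circleCoeff circleMean
  apply intervalIntegral.norm_integral_le_of_norm_le (by positivity)
  · filter_upwards with t _
    have : cexp (m * t * I) = cexp ((m * t : ℝ) * I) := by push_cast; rfl
    rw [norm_mul, this, Complex.norm_exp_ofReal_mul_I, mul_one, Complex.norm_real]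
    exact hfg _ (Complex.norm_exp_ofReal_mul_I t)
  · exact Continuous.intervalIntegrable (by fun_prop) _ _

end Fourier

section Fejer

open Complex Real ComplexConjugate intervalIntegral

/-- The squared modulus of the geometric sum `∑ k < M, exp (i k t)`: up to normalisation,
the Fejér kernel. -/
noncomputable def fejer (M : ℕ) (t : ℝ) : ℝ :=
  ‖∑ k ∈ Finset.range M, cexp (k * t * I)‖ ^ 2

theorem continuous_fejer (M : ℕ) : Continuous (fejer M) := by
  unfold fejer; fun_prop

theorem ofReal_fejer_sub (M : ℕ) (t x : ℝ) :
    (fejer M (t - x) : ℂ) = ∑ j ∈ Finset.range M, ∑ k ∈ Finset.range M,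
      cexp (-((j : ℤ) - (k : ℤ) : ℤ) * x * I) * cexp (((j : ℤ) - (k : ℤ) : ℤ) * t * I) := by
  unfold fejer
  push_cast
  rw [← Complex.mul_conj', map_sum, Finset.sum_mul_sum]
  refine Finset.sum_congr rfl fun j _ => Finset.sum_congr rfl fun k _ => ?_
  rw [← Complex.exp_conj, ← Complex.exp_add, ← Complex.exp_add]
  congr 1
  simp
  ring

theorem integral_mul_fejer {h : ℂ → ℝ} (hh : Continuous h) (M : ℕ) (x : ℝ) :
    ((∫ t in (0 : ℝ)..2 * π, h (cexp (t * I)) * fejer M (t - x) : ℝ) : ℂ) =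
      ∑ j ∈ Finset.range M, ∑ k ∈ Finset.range M,
        cexp (-((j : ℤ) - (k : ℤ) : ℤ) * x * I) * circleCoeff h ((j : ℤ) - (k : ℤ)) := by
  rw [← intervalIntegral.integral_ofReal]
  have h1 : ∀ t : ℝ, ((h (cexp (t * I)) * fejer M (t - x) : ℝ) : ℂ) =
      ∑ j ∈ Finset.range M, ∑ k ∈ Finset.range M,
        cexp (-((j : ℤ) - (k : ℤ) : ℤ) * x * I) *
          ((h (cexp (t * I)) : ℂ) * cexp (((j : ℤ) - (k : ℤ) : ℤ) * t * I)) := by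
    intro t
    push_cast [ofReal_fejer_sub]
    rw [Finset.mul_sum]
    refine Finset.sum_congr rfl fun j _ => ?_
    rw [Finset.mul_sum]
    refine Finset.sum_congr rfl fun k _ => ?_
    ring
  simp_rw [h1]
  rw [intervalIntegral.integral_finsetSum]
  · refine Finset.sum_congr rfl fun j _ => ?_
    rw [intervalIntegral.integral_finsetSum]
    · refine Finset.sum_congr rfl fun k _ => ?_
      rw [intervalIntegral.integral_const_mul]; rfl
    · intro k _
      exact Continuous.intervalIntegrable (by fun_prop) _ _
  · intro k _
    exact Continuous.intervalIntegrable (by fun_prop) _ _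

theorem integral_fejer (M : ℕ) (x : ℝ) :
    ∫ t in (0 : ℝ)..2 * π, fejer M (t - x) = 2 * π * M := by
  have := integral_mul_fejer (h := fun _ => 1) continuous_const M x
  simp only [one_mul, circleCoeff_const] at this
  apply Complex.ofReal_injective
  rw [this]
  have : ∀ j ∈ Finset.range M, ∑ k ∈ Finset.range M,
      cexp (-((j : ℤ) - (k : ℤ) : ℤ) * x * I) *
        ((if (j : ℤ) - (k : ℤ) = 0 then 2 * π * 1 else 0 : ℝ) : ℂ) = 2 * π := by
    intro j hj
    rw [Finset.sum_eq_single j]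
    · simp
    · intro k _ hk
      rw [if_neg (by omega)]; simp
    · intro h; exact absurd hj h
  rw [Finset.sum_congr rfl this]
  simp [mul_comm]

theorem norm_sub_sq_mul_fejer_le (M : ℕ) (t x : ℝ) :
    ‖cexp (x * I) - cexp (t * I)‖ ^ 2 * fejer M (t - x) ≤ 4 := by
  have h1 : cexp (x * I) - cexp (t * I) = - (cexp (x * I) * (cexp ((t - x : ℝ) * I) - 1)) := by
    have : cexp (t * I) = cexp (x * I) * cexp ((t - x : ℝ) * I) := by
      rw [← Complex.exp_add]; congr 1; push_cast; ring
    rw [this]; ring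
  rw [h1, norm_neg, norm_mul, Complex.norm_exp_ofReal_mul_I, one_mul, fejer, ← mul_pow, ← norm_mul,
    mul_comm]
  have h2 : (∑ k ∈ Finset.range M, cexp (k * (t - x : ℝ) * I)) * (cexp ((t - x : ℝ) * I) - 1) =
      cexp ((M * (t - x) : ℝ) * I) - 1 := by
    have := geom_sum_mul (cexp ((t - x : ℝ) * I)) M
    simp_rw [← Complex.exp_nat_mul, ← mul_assoc] at this
    rw [this]; push_cast; rfl
  rw [h2]
  have h3 : ‖cexp ((M * (t - x) : ℝ) * I) - 1‖ ≤ 2 := by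
    refine (norm_sub_le _ _).trans ?_
    rw [Complex.norm_exp_ofReal_mul_I]; norm_num
  nlinarith [norm_nonneg (cexp ((M * (t - x) : ℝ) * I) - 1)]

/-- A Lipschitz function on the circle with uniformly small Fourier coefficients is small. -/
theorem abs_le_of_circleCoeff_le {h : ℂ → ℝ} (hh : Continuous h) {L B : ℝ} (hL : 0 ≤ L)
    (hlip : ∀ x t : ℝ, |h (cexp (x * I)) - h (cexp (t * I))| ≤ L * ‖cexp (x * I) - cexp (t * I)‖)
    (hB : ∀ m, ‖circleCoeff h m‖ ≤ B) {M : ℕ} {η : ℝ} (hη : 0 < η) (hM : 1 ≤ M * η ^ 2) (x : ℝ) :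
    |h (cexp (x * I))| ≤ M * B + 3 * L * η := by
  have hM0 : (0 : ℝ) < M := by
    by_contra hcon
    have : (M : ℝ) = 0 := le_antisymm (not_lt.1 hcon) (Nat.cast_nonneg M)
    rw [this] at hM; norm_num at hM
  have hB0 : 0 ≤ B := (norm_nonneg _).trans (hB 0)
  set J := ∫ t in (0 : ℝ)..2 * π, h (cexp (t * I)) * fejer M (t - x) with hJ
  have hcf := continuous_fejer M
  have hJle : |J| ≤ M * (M * B) := by
    have h1 : ‖(J : ℂ)‖ = |J| := Complex.norm_real J
    rw [← h1, hJ, integral_mul_fejer hh]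
    refine (norm_sum_le _ _).trans ?_
    have : ∀ j ∈ Finset.range M, ‖∑ k ∈ Finset.range M,
        cexp (-((j : ℤ) - (k : ℤ) : ℤ) * x * I) * circleCoeff h ((j : ℤ) - (k : ℤ))‖ ≤ M * B := by
      intro j _
      refine (norm_sum_le _ _).trans ?_
      have : ∀ k ∈ Finset.range M, ‖cexp (-((j : ℤ) - (k : ℤ) : ℤ) * x * I) *
          circleCoeff h ((j : ℤ) - (k : ℤ))‖ ≤ B := by
        intro k _
        have e : cexp (-((j : ℤ) - (k : ℤ) : ℤ) * x * I) =
            cexp ((-((j : ℤ) - (k : ℤ) : ℤ) * x : ℝ) * I) := by push_cast; rfl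
        rw [norm_mul, e, Complex.norm_exp_ofReal_mul_I, one_mul]
        exact hB _
      simpa using Finset.sum_le_sum this
    simpa using Finset.sum_le_sum this
  have hdiff : h (cexp (x * I)) * (2 * π * M) - J =
      ∫ t in (0 : ℝ)..2 * π, (h (cexp (x * I)) - h (cexp (t * I))) * fejer M (t - x) := by
    rw [hJ, ← integral_fejer M x, ← intervalIntegral.integral_const_mul,
      ← intervalIntegral.integral_sub]
    · congr 1; ext t; ring
    · exact Continuous.intervalIntegrable (by fun_prop) _ _
    · exact Continuous.intervalIntegrable (by fun_prop) _ _
  have hbound : |h (cexp (x * I)) * (2 * π * M) - J| ≤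
      ∫ t in (0 : ℝ)..2 * π, L / 2 * (η * fejer M (t - x) + 4 / η) := by
    rw [hdiff, ← Real.norm_eq_abs]
    apply intervalIntegral.norm_integral_le_of_norm_le (by positivity)
    · filter_upwards with t _
      have hF : 0 ≤ fejer M (t - x) := by unfold fejer; positivity
      have h1 := norm_sub_sq_mul_fejer_le M t x
      have h2 := hlip x t
      set d := ‖cexp (x * I) - cexp (t * I)‖ with hd
      have hd0 : 0 ≤ d := norm_nonneg _
      have h3 : d * fejer M (t - x) ≤ (η * fejer M (t - x) + 4 / η) / 2 := by
        have h4 : d ≤ (η + d ^ 2 / η) / 2 := by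
          rw [le_div_iff₀ (by norm_num), ← sub_nonneg]
          have : η + d ^ 2 / η - d * 2 = (d - η) ^ 2 / η := by field_simp; ring
          rw [this]; positivity
        calc d * fejer M (t - x) ≤ (η + d ^ 2 / η) / 2 * fejer M (t - x) := by gcongr
          _ = (η * fejer M (t - x) + (d ^ 2 * fejer M (t - x)) / η) / 2 := by ring
          _ ≤ _ := by gcongr
      rw [Real.norm_eq_abs, abs_mul, abs_of_nonneg hF]
      calc _ ≤ L * d * fejer M (t - x) := by gcongr
        _ = L * (d * fejer M (t - x)) := by ring
        _ ≤ L * ((η * fejer M (t - x) + 4 / η) / 2) := by gcongr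
        _ = _ := by ring
    · exact Continuous.intervalIntegrable (by fun_prop) _ _
  rw [intervalIntegral.integral_const_mul, intervalIntegral.integral_add
    (Continuous.intervalIntegrable (by fun_prop) _ _)
    (Continuous.intervalIntegrable (by fun_prop) _ _), intervalIntegral.integral_const_mul,
    integral_fejer] at hbound
  simp only [intervalIntegral.integral_const, sub_zero, smul_eq_mul] at hbound
  have h5 : |h (cexp (x * I))| * (2 * π * M) ≤
      M * (M * B) + L / 2 * (η * (2 * π * M) + 2 * π * (4 / η)) := by
    have e : |h (cexp (x * I))| * (2 * π * M) = |h (cexp (x * I)) * (2 * π * M)| := by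
      rw [abs_mul, abs_of_nonneg (by positivity : 0 ≤ 2 * π * (M : ℝ))]
    rw [e]
    have := abs_sub_abs_le_abs_sub (h (cexp (x * I)) * (2 * π * M)) J
    linarith
  have h6 : 4 / η ≤ 4 * M * η := by
    rw [div_le_iff₀ hη]; nlinarith
  have h7 : L / 2 * (η * (2 * π * M) + 2 * π * (4 / η)) ≤ 5 * L * η * (π * M) := by
    calc _ ≤ L / 2 * (η * (2 * π * M) + 2 * π * (4 * M * η)) := by gcongr
      _ = _ := by ring
  have h8 : M * (M * B) ≤ 2 * (M * B) * (π * M) := by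
    have := Real.pi_gt_three
    have h9 : 0 ≤ M * (M * B) := by positivity
    nlinarith
  have h10 : 0 < π * (M : ℝ) := by positivity
  have h11 : |h (cexp (x * I))| * 2 ≤ 2 * (M * B) + 5 * L * η := by
    refine le_of_mul_le_mul_right ?_ h10
    nlinarith
  nlinarith [mul_nonneg hL hη.le]

end Fejer

section Support

open Complex ComplexConjugate

/-- The support function of a planar set. -/
noncomputable def supp (K : Set ℂ) (ξ : ℂ) : ℝ := sSup ((fun x => inner ℝ x ξ) '' K)

/-- Planar convex bodies containing the origin in their interior. -/
structure IsBody (K : Set ℂ) : Prop where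
  isCompact : IsCompact K
  convex : Convex ℝ K
  zero_mem_interior : (0 : ℂ) ∈ interior K

theorem IsBody.zero_mem {K : Set ℂ} (hK : IsBody K) : (0 : ℂ) ∈ K :=
  interior_subset hK.zero_mem_interior

theorem IsBody.nonempty {K : Set ℂ} (hK : IsBody K) : K.Nonempty := ⟨0, hK.zero_mem⟩

theorem inner_le_supp {K : Set ℂ} (hK : IsCompact K) {x : ℂ} (hx : x ∈ K) (ξ : ℂ) :
    inner ℝ x ξ ≤ supp K ξ :=
  le_csSup (hK.image (by fun_prop)).bddAbove (mem_image_of_mem _ hx)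

theorem supp_le {K : Set ℂ} (hK : K.Nonempty) {ξ : ℂ} {c : ℝ} (h : ∀ x ∈ K, inner ℝ x ξ ≤ c) :
    supp K ξ ≤ c :=
  csSup_le (hK.image _) (by rintro _ ⟨x, hx, rfl⟩; exact h x hx)

theorem supp_image (A : ℂ →ₗ[ℝ] ℂ) (K : Set ℂ) (ξ : ℂ) :
    supp (A '' K) ξ = supp K (LinearMap.adjoint A ξ) := by
  simp only [supp, image_image, LinearMap.adjoint_inner_right]

theorem IsBody.supp_nonneg {K : Set ℂ} (hK : IsBody K) (ξ : ℂ) : 0 ≤ supp K ξ := by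
  simpa using inner_le_supp hK.isCompact hK.zero_mem ξ

theorem supp_le_of_subset_image_add {K L : Set ℂ} (hK : K.Nonempty) (hL : IsCompact L)
    {A : ℂ →ₗ[ℝ] ℂ} {v : ℂ} (h : K ⊆ A '' L + {v}) (ξ : ℂ) :
    supp K ξ ≤ supp L (LinearMap.adjoint A ξ) + inner ℝ v ξ := by
  refine supp_le hK fun x hx => ?_
  obtain ⟨_, ⟨y, hy, rfl⟩, _, rfl, rfl⟩ := h hx
  rw [inner_add_left, ← LinearMap.adjoint_inner_right]
  gcongr
  exact inner_le_supp hL hy _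

theorem supp_adjoint_le_of_image_subset {K L : Set ℂ} (hK : IsCompact K) (hL : L.Nonempty)
    {A : ℂ →ₗ[ℝ] ℂ} {z : ℂ} {c : ℝ} (hc : 0 ≤ c) (h : A '' L ⊆ c • K + {z}) (ξ : ℂ) :
    supp L (LinearMap.adjoint A ξ) ≤ c * supp K ξ + inner ℝ z ξ := by
  refine supp_le hL fun x hx => ?_
  rw [LinearMap.adjoint_inner_right]
  obtain ⟨_, ⟨y, hy, rfl⟩, _, rfl, e⟩ := h (mem_image_of_mem A hx)
  rw [← e]
  simp only [inner_add_left, real_inner_smul_left]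
  gcongr
  exact inner_le_supp hK hy _

theorem abs_supp_sub_le {K : Set ℂ} (hK : IsCompact K) (hne : K.Nonempty) {R : ℝ}
    (hR : ∀ x ∈ K, ‖x‖ ≤ R) (ξ ζ : ℂ) : |supp K ξ - supp K ζ| ≤ R * ‖ξ - ζ‖ := by
  have key : ∀ ξ ζ : ℂ, supp K ξ ≤ supp K ζ + R * ‖ξ - ζ‖ := by
    intro ξ ζ
    refine supp_le hne fun x hx => ?_
    have h1 : inner ℝ x ξ = inner ℝ x ζ + inner ℝ x (ξ - ζ) := by rw [inner_sub_right]; ring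
    rw [h1]
    have h2 := inner_le_supp hK hx ζ
    have h3 := real_inner_le_norm x (ξ - ζ)
    have h4 := mul_le_mul_of_nonneg_right (hR x hx) (norm_nonneg (ξ - ζ))
    linarith
  rw [abs_le]
  have h1 := key ξ ζ
  have h2 := key ζ ξ
  rw [norm_sub_rev] at h2
  constructor <;> linarith

theorem IsBody.continuous_supp {K : Set ℂ} (hK : IsBody K) : Continuous (supp K) := by
  obtain ⟨R, hR⟩ := hK.isCompact.isBounded.exists_norm_le
  have hR0 : 0 ≤ R := by simpa using hR 0 hK.zero_mem
  have : LipschitzWith ⟨R, hR0⟩ (supp K) := LipschitzWith.of_dist_le_mul fun ξ ζ => by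
    rw [Real.dist_eq, dist_eq_norm]
    exact abs_supp_sub_le hK.isCompact hK.nonempty hR ξ ζ
  exact this.continuous

/-- The elements of a body are controlled by its mean width. -/
theorem IsBody.norm_le_circleMean {K : Set ℂ} (hK : IsBody K) {x : ℂ} (hx : x ∈ K) :
    ‖x‖ ≤ circleMean (supp K) := by
  have hc := hK.continuous_supp
  have h1 : ‖circleCoeff (fun ξ => inner ℝ ((1 / 2 : ℝ) • x) ξ) 1‖ ≤
      circleMean (fun ξ => supp K ξ - inner ℝ ((1 / 2 : ℝ) • x) ξ) := by
    refine norm_circleCoeff_le (by fun_prop) (fun ξ _ => ?_) 1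
    have h1 := inner_le_supp hK.isCompact hx ξ
    have h2 := hK.supp_nonneg ξ
    rw [real_inner_smul_left, abs_le]
    constructor <;> linarith
  have h2 : circleMean (fun ξ => supp K ξ - inner ℝ ((1 / 2 : ℝ) • x) ξ) = circleMean (supp K) := by
    apply Complex.ofReal_injective
    rw [← circleCoeff_zero, ← circleCoeff_zero, circleCoeff_sub hc (by fun_prop), circleCoeff_inner]
    simp
  rw [h2, circleCoeff_inner] at h1
  simp only [show ¬ (1 : ℤ) = -1 by norm_num, if_false, if_true, zero_add, norm_mul, norm_smul] at h1
  rw [Complex.norm_real, Real.norm_of_nonneg Real.pi_pos.le] at h1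
  norm_num at h1
  have := Real.pi_gt_three
  nlinarith [norm_nonneg x]

theorem IsBody.circleMean_pos {K : Set ℂ} (hK : IsBody K) : 0 < circleMean (supp K) := by
  obtain ⟨r, hr, hball⟩ := Metric.isOpen_iff.1 isOpen_interior 0 hK.zero_mem_interior
  have hx : ((r / 2 : ℝ) : ℂ) ∈ K := interior_subset (hball (by
    rw [mem_ball_zero_iff, Complex.norm_real, Real.norm_of_nonneg (by positivity)]; linarith))
  have := hK.norm_le_circleMean hx
  rw [Complex.norm_real, Real.norm_of_nonneg (by positivity)] at this
  linarith

theorem IsBody.image {K : Set ℂ} (hK : IsBody K) (A : ℂ ≃ₗ[ℝ] ℂ) : IsBody (A '' K) where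
  isCompact := hK.isCompact.image (A.toContinuousLinearEquiv.continuous)
  convex := hK.convex.linear_image (A : ℂ →ₗ[ℝ] ℂ)
  zero_mem_interior := by
    have := A.toContinuousLinearEquiv.toHomeomorph.image_interior K
    have h2 : (0 : ℂ) ∈ A '' interior K := ⟨0, hK.zero_mem_interior, map_zero A⟩
    change A '' interior K = interior (A '' K) at this
    rwa [← this]

end Support

section NearlyOrthogonal

open Complex ComplexConjugate

/-- A linear map of the plane that distorts all lengths by almost the same factor is close to a
multiple of an orthogonal map. -/
theorem exists_orthogonal_near {B : ℂ →ₗ[ℝ] ℂ} {ρ γ : ℝ} (hρ : 0 < ρ)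
    (h1 : ∀ ξ, ρ * ‖ξ‖ ≤ ‖B ξ‖) (h2 : ∀ ξ, ‖B ξ‖ ≤ (1 + γ) * ρ * ‖ξ‖) :
    ∃ u : ℂ, ‖u‖ = 1 ∧ ((∀ ξ, ‖B ξ - ρ * (u * ξ)‖ ≤ γ * ρ * ‖ξ‖) ∨
      ∀ ξ, ‖B ξ - ρ * (u * conj ξ)‖ ≤ γ * ρ * ‖ξ‖) := by
  obtain ⟨α, β, hB⟩ : ∃ α β : ℂ, ∀ ξ, B ξ = α * ξ + β * conj ξ := by
    refine ⟨(B 1 - I * B I) / 2, (B 1 + I * B I) / 2, fun ξ => ?_⟩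
    have e : ξ = ξ.re • (1 : ℂ) + ξ.im • I := by
      simp [Complex.re_add_im]
    have e1 : B ξ = ξ.re * B 1 + ξ.im * B I := by
      conv_lhs => rw [e]
      rw [map_add, map_smul, map_smul]
      simp
    have e2 : conj ξ = ξ.re - ξ.im * I := by
      apply Complex.ext <;> simp
    have e3 : ξ = ξ.re + ξ.im * I := (Complex.re_add_im ξ).symm
    rw [e1, e2]
    linear_combination (ξ.im * B I) * Complex.I_sq - (B 1 - I * B I) / 2 * e3
  set e : ℂ := cexp (((β.arg - α.arg) / 2 : ℝ) * I) with he
  set c : ℂ := cexp (((β.arg + α.arg) / 2 : ℝ) * I) with hc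
  have hen : ‖e‖ = 1 := Complex.norm_exp_ofReal_mul_I _
  have hcn : ‖c‖ = 1 := Complex.norm_exp_ofReal_mul_I _
  have hαe : α * e = ‖α‖ * c := by
    conv_lhs => rw [← Complex.norm_mul_exp_arg_mul_I α]
    rw [mul_assoc, he, hc, ← Complex.exp_add]
    congr 2; push_cast; ring
  have hβe : β * conj e = ‖β‖ * c := by
    conv_lhs => rw [← Complex.norm_mul_exp_arg_mul_I β]
    rw [mul_assoc, he, hc, ← Complex.exp_conj, ← Complex.exp_add, map_mul, Complex.conj_ofReal,
      Complex.conj_I]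
    congr 2; push_cast; ring
  have hsum : ‖α‖ + ‖β‖ ≤ (1 + γ) * ρ := by
    have := h2 e
    rw [hB, hαe, hβe, hen, mul_one, ← add_mul, norm_mul, hcn, mul_one, ← ofReal_add,
      Complex.norm_real, Real.norm_of_nonneg (by positivity)] at this
    exact this
  have hdiff : ρ ≤ |‖α‖ - ‖β‖| := by
    have := h1 (I * e)
    rw [hB, norm_mul, hen, Complex.norm_I, mul_one, mul_one, map_mul, Complex.conj_I] at this
    have e4 : α * (I * e) + β * (-I * conj e) = I * ((‖α‖ - ‖β‖ : ℝ) * c) := by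
      push_cast
      linear_combination I * hαe - I * hβe
    rwa [e4, norm_mul, norm_mul, hcn, Complex.norm_I, Complex.norm_real, one_mul, mul_one] at this
  rcases le_total ‖β‖ ‖α‖ with h | h
  · rw [abs_of_nonneg (by linarith)] at hdiff
    have hα0 : 0 < ‖α‖ := by linarith [norm_nonneg β]
    have hα0' : (‖α‖ : ℂ) ≠ 0 := by exact_mod_cast hα0.ne'
    refine ⟨α / ‖α‖, by simp [hα0.ne'], Or.inl fun ξ => ?_⟩
    have e5 : B ξ - ρ * (α / ‖α‖ * ξ) = ((‖α‖ - ρ : ℝ) : ℂ) * (α / ‖α‖) * ξ + β * conj ξ := by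
      rw [hB]; field_simp; push_cast; ring
    rw [e5]
    refine (norm_add_le _ _).trans ?_
    rw [norm_mul, norm_mul, norm_mul, RCLike.norm_conj, Complex.norm_real,
      Real.norm_of_nonneg (by linarith [norm_nonneg β]), norm_div, Complex.norm_real, norm_norm,
      div_self hα0.ne', mul_one, ← add_mul]
    gcongr
    linarith
  · rw [abs_of_nonpos (by linarith)] at hdiff
    have hβ0 : 0 < ‖β‖ := by linarith [norm_nonneg α]
    have hβ0' : (‖β‖ : ℂ) ≠ 0 := by exact_mod_cast hβ0.ne'
    refine ⟨β / ‖β‖, by simp [hβ0.ne'], Or.inr fun ξ => ?_⟩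
    have e5 : B ξ - ρ * (β / ‖β‖ * conj ξ) =
        α * ξ + ((‖β‖ - ρ : ℝ) : ℂ) * (β / ‖β‖) * conj ξ := by
      rw [hB]; field_simp; push_cast; ring
    rw [e5]
    refine (norm_add_le _ _).trans ?_
    rw [norm_mul, norm_mul, norm_mul, RCLike.norm_conj, Complex.norm_real,
      Real.norm_of_nonneg (by linarith [norm_nonneg α]), norm_div, Complex.norm_real, norm_norm,
      div_self hβ0.ne', mul_one, ← add_mul]
    gcongr
    linarith

end NearlyOrthogonal

section Moment

open Complex ComplexConjugate MeasureTheory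

/-- The second moment, in direction `ξ`, of the difference body of `K`. -/
noncomputable def moment (K : Set ℂ) (ξ : ℂ) : ℝ := ∫ x in K - K, (inner ℝ x ξ) ^ 2

theorem isCompact_sub {K L : Set ℂ} (hK : IsCompact K) (hL : IsCompact L) :
    IsCompact (K - L) := by
  rw [← Set.sub_image_prod]
  exact (hK.prod hL).image continuous_sub

theorem integrableOn_inner_sq {D : Set ℂ} (hD : IsCompact D) (ξ : ℂ) :
    IntegrableOn (fun x : ℂ => (inner ℝ x ξ : ℝ) ^ 2) D :=
  Continuous.continuousOn (by fun_prop) |>.integrableOn_compact hD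

theorem setIntegral_inner_sq_mono {D D' : Set ℂ} (hD' : IsCompact D') (h : D ⊆ D') (ξ : ℂ) :
    ∫ x in D, (inner ℝ x ξ : ℝ) ^ 2 ≤ ∫ x in D', (inner ℝ x ξ : ℝ) ^ 2 :=
  setIntegral_mono_set (integrableOn_inner_sq hD' ξ) (ae_of_all _ fun _ => sq_nonneg _)
    h.eventuallyLE

theorem setIntegral_inner_sq_image (A : ℂ ≃ₗ[ℝ] ℂ) {D : Set ℂ} (hD : IsCompact D) (ξ : ℂ) :
    ∫ x in A '' D, (inner ℝ x ξ : ℝ) ^ 2 = |LinearMap.det (A : ℂ →ₗ[ℝ] ℂ)| *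
      ∫ x in D, (inner ℝ x (LinearMap.adjoint (A : ℂ →ₗ[ℝ] ℂ) ξ) : ℝ) ^ 2 := by
  have h := integral_image_eq_integral_abs_det_fderiv_smul volume hD.measurableSet
    (f := A) (f' := fun _ => (A.toContinuousLinearEquiv : ℂ →L[ℝ] ℂ))
    (fun x _ => (A.toContinuousLinearEquiv : ℂ →L[ℝ] ℂ).hasFDerivWithinAt) A.injective.injOn
    (fun x => (inner ℝ x ξ : ℝ) ^ 2)
  rw [h, ← integral_const_mul]
  simp only [LinearMap.adjoint_inner_right, smul_eq_mul]
  rfl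

theorem setIntegral_inner_sq_smul {c : ℝ} (hc : 0 < c) {D : Set ℂ} (hD : IsCompact D) (ξ : ℂ) :
    ∫ x in c • D, (inner ℝ x ξ : ℝ) ^ 2 = c ^ 4 * ∫ x in D, (inner ℝ x ξ : ℝ) ^ 2 := by
  have h := setIntegral_inner_sq_image (LinearEquiv.smulOfNeZero ℝ ℂ c hc.ne') hD ξ
  have e : (LinearEquiv.smulOfNeZero ℝ ℂ c hc.ne' : ℂ →ₗ[ℝ] ℂ) = c • LinearMap.id := by
    ext; simp
  have e2 : (LinearEquiv.smulOfNeZero ℝ ℂ c hc.ne') '' D = c • D := rfl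
  rw [e2, e, LinearMap.det_smul] at h
  rw [h]
  simp only [map_smulₛₗ, LinearMap.adjoint_id, Complex.finrank_real_complex, LinearMap.det_id]
  simp only [LinearMap.smul_apply, LinearMap.id_apply, real_inner_smul_right,
    conj_trivial]
  rw [← integral_const_mul, ← integral_const_mul]
  congr 1; ext x
  rw [mul_one, abs_of_nonneg (by positivity)]; ring

theorem moment_mono {K L : Set ℂ} (hL : IsCompact L) (h : K ⊆ L) (ξ : ℂ) :
    moment K ξ ≤ moment L ξ :=
  setIntegral_inner_sq_mono (isCompact_sub hL hL) (sub_subset_sub h h) ξ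

theorem moment_image (A : ℂ ≃ₗ[ℝ] ℂ) {K : Set ℂ} (hK : IsCompact K) (ξ : ℂ) :
    moment (A '' K) ξ = |LinearMap.det (A : ℂ →ₗ[ℝ] ℂ)| *
      moment K (LinearMap.adjoint (A : ℂ →ₗ[ℝ] ℂ) ξ) := by
  rw [moment, ← Set.image_sub, setIntegral_inner_sq_image A (isCompact_sub hK hK), moment]

theorem sub_subset_of_subset_add {D E : Set ℂ} {v : ℂ} (h : D ⊆ E + {v}) : D - D ⊆ E - E := by
  rintro _ ⟨x, hx, y, hy, rfl⟩
  obtain ⟨x', hx', _, rfl, rfl⟩ := h hx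
  obtain ⟨y', hy', _, rfl, rfl⟩ := h hy
  exact ⟨x', hx', y', hy', by simp⟩

theorem moment_smul {c : ℝ} (hc : 0 < c) {K : Set ℂ} (hK : IsCompact K) (ξ : ℂ) :
    moment (c • K) ξ = c ^ 4 * moment K ξ := by
  have e : c • K - c • K = c • (K - K) :=
    (Set.image_sub (LinearMap.lsmul ℝ ℂ c)).symm
  rw [moment, e, setIntegral_inner_sq_smul hc (isCompact_sub hK hK), moment]

theorem moment_le_of_subset_add {K L : Set ℂ} (hL : IsCompact L) {v : ℂ} (h : K ⊆ L + {v})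
    (ξ : ℂ) : moment K ξ ≤ moment L ξ :=
  setIntegral_inner_sq_mono (isCompact_sub hL hL) (sub_subset_of_subset_add h) ξ

theorem IsBody.moment_pos {K : Set ℂ} (hK : IsBody K) {ξ : ℂ} (hξ : ξ ≠ 0) : 0 < moment K ξ := by
  unfold moment
  rw [setIntegral_pos_iff_support_of_nonneg_ae (ae_of_all _ fun _ => sq_nonneg _)
    (integrableOn_inner_sq (isCompact_sub hK.isCompact hK.isCompact) ξ)]
  have hsub : K ⊆ K - K := fun x hx => ⟨x, hx, 0, hK.zero_mem, sub_zero x⟩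
  have ho : IsOpen ({x : ℂ | (inner ℝ x ξ : ℝ) ≠ 0} ∩ interior K) :=
    (isOpen_ne_fun (by fun_prop) (by fun_prop)).inter isOpen_interior
  refine (ho.measure_pos volume ?_).trans_le (measure_mono ?_)
  · have hc : Filter.Tendsto (fun t : ℝ => t • ξ) (nhdsWithin 0 (Ioi 0)) (nhds 0) := by
      have : Continuous (fun t : ℝ => t • ξ) := by fun_prop
      simpa using (this.tendsto 0).mono_left nhdsWithin_le_nhds
    have h1 := hc.eventually (isOpen_interior.mem_nhds hK.zero_mem_interior)
    obtain ⟨t, ht, ht0⟩ := (h1.and self_mem_nhdsWithin).exists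
    refine ⟨t • ξ, ?_, ht⟩
    have : 0 < ‖ξ‖ := norm_pos_iff.2 hξ
    have ht0 : (0 : ℝ) < t := ht0
    simp only [mem_ofPred_eq, real_inner_smul_left, real_inner_self_eq_norm_sq]
    positivity
  · rintro x ⟨hx, hx'⟩
    refine ⟨?_, hsub (interior_subset hx')⟩
    simpa [Function.mem_support] using hx

/-- The trace part of the quadratic form `moment K`. -/
noncomputable def momentP (K : Set ℂ) : ℝ := (moment K 1 + moment K I) / 2

/-- The traceless part of the quadratic form `moment K`. -/
noncomputable def momentQ (K : Set ℂ) : ℂ :=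
  ⟨(moment K 1 - moment K I) / 2, (moment K (1 + I) - moment K 1 - moment K I) / 2⟩

theorem moment_eq {K : Set ℂ} (hK : IsCompact K) (ξ : ℂ) :
    moment K ξ = momentP K * ‖ξ‖ ^ 2 + (momentQ K * conj ξ ^ 2).re := by
  have hi := integrableOn_inner_sq (isCompact_sub hK hK)
  have h : moment K ξ = ξ.re ^ 2 * moment K 1 + ξ.im ^ 2 * moment K I +
      ξ.re * ξ.im * (moment K (1 + I) - moment K 1 - moment K I) := by
    have e : ∀ x : ℂ, (inner ℝ x ξ : ℝ) ^ 2 =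
        (ξ.re ^ 2 - ξ.re * ξ.im) * (inner ℝ x 1 : ℝ) ^ 2 +
          (ξ.im ^ 2 - ξ.re * ξ.im) * (inner ℝ x I : ℝ) ^ 2 +
          ξ.re * ξ.im * (inner ℝ x (1 + I) : ℝ) ^ 2 := by
      intro x
      simp [Complex.inner]
      ring
    unfold moment
    simp_rw [e]
    have h12 : IntegrableOn (fun x : ℂ => (ξ.re ^ 2 - ξ.re * ξ.im) * (inner ℝ x 1 : ℝ) ^ 2 +
        (ξ.im ^ 2 - ξ.re * ξ.im) * (inner ℝ x I : ℝ) ^ 2) (K - K) :=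
      ((hi _).const_mul _).add ((hi _).const_mul _)
    rw [integral_add h12 ((hi _).const_mul _),
      integral_add ((hi _).const_mul _) ((hi _).const_mul _),
      integral_const_mul, integral_const_mul, integral_const_mul]
    ring
  rw [h, momentP, momentQ, ← Complex.normSq_eq_norm_sq, Complex.normSq_apply]
  simp [pow_two]
  ring

theorem IsBody.norm_momentQ_lt {K : Set ℂ} (hK : IsBody K) : ‖momentQ K‖ < momentP K := by
  set q := momentQ K with hq
  set e : ℂ := cexp (((q.arg + Real.pi) / 2 : ℝ) * I) with he
  have hen : ‖e‖ = 1 := Complex.norm_exp_ofReal_mul_I _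
  have h := hK.moment_pos (ξ := e) (Complex.exp_ne_zero _)
  rw [moment_eq hK.isCompact, hen, ← hq] at h
  have : q * conj e ^ 2 = (-‖q‖ : ℝ) := by
    conv_lhs => rw [← Complex.norm_mul_exp_arg_mul_I q]
    rw [he, ← Complex.exp_conj, ← Complex.exp_nat_mul, mul_assoc, ← Complex.exp_add, map_mul,
      Complex.conj_ofReal, Complex.conj_I]
    have e1 : (q.arg : ℂ) * I + (2 : ℕ) * ((((q.arg + Real.pi) / 2 : ℝ) : ℂ) * -I) =
        -(Real.pi * I) := by push_cast; ring
    rw [e1, Complex.exp_neg, Complex.exp_pi_mul_I]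
    push_cast; norm_num
  rw [this, Complex.ofReal_re] at h
  linarith

/-- The larger coefficient of the normalising map. -/
noncomputable def normA (K : Set ℂ) : ℝ :=
  momentP K + √(momentP K ^ 2 - ‖momentQ K‖ ^ 2)

/-- The self-adjoint linear map bringing `K` into isotropic position. -/
noncomputable def normMap (K : Set ℂ) : ℂ →ₗ[ℝ] ℂ :=
  (normA K) • LinearMap.id - (LinearMap.mulLeft ℝ (momentQ K)).comp conjAe.toLinearMap

theorem normMap_apply (K : Set ℂ) (x : ℂ) :
    normMap K x = normA K * x - momentQ K * conj x := by
  simp [normMap]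

theorem IsBody.normMap_injective {K : Set ℂ} (hK : IsBody K) :
    Function.Injective (normMap K) := by
  rw [injective_iff_map_eq_zero]
  intro x hx
  rw [normMap_apply, sub_eq_zero] at hx
  by_contra hx0
  have h1 := congrArg norm hx
  have hlt := hK.norm_momentQ_lt
  have hp : 0 < momentP K := (norm_nonneg _).trans_lt hlt
  have ha : momentP K ≤ normA K := by
    unfold normA
    linarith [Real.sqrt_nonneg (momentP K ^ 2 - ‖momentQ K‖ ^ 2)]
  rw [norm_mul, norm_mul, RCLike.norm_conj, Complex.norm_real, Real.norm_of_nonneg (by linarith)] at h1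
  have := mul_right_cancel₀ (norm_ne_zero_iff.2 hx0) h1
  linarith

/-- `normMap` as a linear equivalence. -/
noncomputable def normEquiv (K : Set ℂ) (hK : IsBody K) : ℂ ≃ₗ[ℝ] ℂ :=
  LinearEquiv.ofInjectiveEndo (normMap K) hK.normMap_injective

theorem coe_normEquiv {K : Set ℂ} (hK : IsBody K) :
    (normEquiv K hK : ℂ →ₗ[ℝ] ℂ) = normMap K := rfl

theorem adjoint_normMap (K : Set ℂ) : LinearMap.adjoint (normMap K) = normMap K := by
  symm
  rw [LinearMap.eq_adjoint_iff]
  intro x y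
  simp only [normMap_apply, Complex.inner]
  simp
  ring

/-- The isotropic position of a planar body. -/
noncomputable def isotropicPosition (K : Set ℂ) : Set ℂ := normMap K '' K

theorem IsBody.isBody_isotropicPosition {K : Set ℂ} (hK : IsBody K) : IsBody (isotropicPosition K) :=
  hK.image (normEquiv K hK)

theorem supp_isotropicPosition (K : Set ℂ) (ξ : ℂ) :
    supp (isotropicPosition K) ξ = supp K (normMap K ξ) := by
  rw [isotropicPosition, supp_image, adjoint_normMap]

theorem IsBody.moment_normMap {K : Set ℂ} (hK : IsBody K) (ξ : ℂ) :
    moment K (normMap K ξ) =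
      (momentP K * (normA K ^ 2 + ‖momentQ K‖ ^ 2) - 2 * normA K * ‖momentQ K‖ ^ 2) * ‖ξ‖ ^ 2 := by
  have ha : normA K ^ 2 - 2 * momentP K * normA K + ‖momentQ K‖ ^ 2 = 0 := by
    have hlt := hK.norm_momentQ_lt
    have : 0 ≤ momentP K ^ 2 - ‖momentQ K‖ ^ 2 := by nlinarith [norm_nonneg (momentQ K)]
    have := Real.sq_sqrt this
    unfold normA
    linear_combination this
  rw [moment_eq hK.isCompact, normMap_apply]
  rw [← Complex.normSq_eq_norm_sq] at ha ⊢
  rw [← Complex.normSq_eq_norm_sq, ← Complex.normSq_eq_norm_sq]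
  generalize normA K = a at *
  generalize momentP K = p at *
  generalize momentQ K = q at *
  rw [Complex.normSq_apply] at *
  rw [Complex.normSq_apply, Complex.normSq_apply]
  simp [pow_two]
  linear_combination (q.re * (ξ.re ^ 2 - ξ.im ^ 2) + 2 * q.im * ξ.re * ξ.im) * ha

/-- A set is isotropic when the second moments of its difference body are the same in all
directions. -/
def IsIsotropic (K : Set ℂ) : Prop := ∃ κ : ℝ, 0 < κ ∧ ∀ ξ, moment K ξ = κ * ‖ξ‖ ^ 2

theorem IsBody.isIsotropic_isotropicPosition {K : Set ℂ} (hK : IsBody K) :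
    IsIsotropic (isotropicPosition K) := by
  have h := moment_image (normEquiv K hK) hK.isCompact
  rw [coe_normEquiv, adjoint_normMap] at h
  have h2 : ∀ ξ, moment (isotropicPosition K) ξ = moment (isotropicPosition K) 1 * ‖ξ‖ ^ 2 := by
    intro ξ
    change ∀ ξ, moment (isotropicPosition K) ξ = _ at h
    rw [h, h, hK.moment_normMap, hK.moment_normMap]
    simp [mul_assoc]
  exact ⟨_, hK.isBody_isotropicPosition.moment_pos one_ne_zero, h2⟩

end Moment

section Stability

open Complex ComplexConjugate

theorem supp_real_mul (K : Set ℂ) {ρ : ℝ} (hρ : 0 ≤ ρ) (ξ : ℂ) : supp K (ρ * ξ) = ρ * supp K ξ := by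
  have e : (fun x : ℂ => (inner ℝ x (ρ * ξ) : ℝ)) '' K = ρ • ((fun x => inner ℝ x ξ) '' K) := by
    rw [← image_smul, image_image]
    congr 1; ext x
    rw [← Complex.real_smul, real_inner_smul_right, smul_eq_mul]
  rw [supp, e, Real.sSup_smul_of_nonneg hρ, smul_eq_mul, supp]

theorem circleMean_const (c : ℝ) : circleMean (fun _ => c) = 2 * Real.pi * c := by
  apply Complex.ofReal_injective
  rw [← circleCoeff_zero, circleCoeff_const, if_pos rfl]

theorem circleMean_add_inner {h : ℂ → ℝ} (hh : Continuous h) (v : ℂ) :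
    circleMean (fun ξ => h ξ + inner ℝ v ξ) = circleMean h := by
  apply Complex.ofReal_injective
  rw [← circleCoeff_zero, ← circleCoeff_zero, circleCoeff_add hh (by fun_prop), circleCoeff_inner]
  simp

theorem circleMean_const_mul (c : ℝ) (h : ℂ → ℝ) :
    circleMean (fun ξ => c * h ξ) = c * circleMean h := by
  apply Complex.ofReal_injective
  rw [← circleCoeff_zero, circleCoeff_const_mul, circleCoeff_zero, Complex.ofReal_mul]

/-- A linear map that almost maps one isotropic body onto another is close to a similarity. -/
theorem IsIsotropic.exists_scale {K L : Set ℂ} (hK : IsBody K) (hL : IsBody L)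
    (iK : IsIsotropic K) (iL : IsIsotropic L) {A : ℂ ≃ₗ[ℝ] ℂ} {v z : ℂ} {δ : ℝ} (hδ : 0 < δ)
    (hδ' : δ ≤ 1) (h1 : K ⊆ A '' L + {v}) (h2 : A '' L ⊆ (1 + δ) • K + {z}) :
    ∃ ρ : ℝ, 0 < ρ ∧ ∀ ξ, ρ * ‖ξ‖ ≤ ‖LinearMap.adjoint (A : ℂ →ₗ[ℝ] ℂ) ξ‖ ∧
      ‖LinearMap.adjoint (A : ℂ →ₗ[ℝ] ℂ) ξ‖ ≤ (1 + 3 * δ) * ρ * ‖ξ‖ := by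
  obtain ⟨κ, hκ, hKm⟩ := iK
  obtain ⟨μ, hμ, hLm⟩ := iL
  have hAL := hL.image A
  set d := |LinearMap.det (A : ℂ →ₗ[ℝ] ℂ)| with hd
  have hd0 : 0 < d := abs_pos.2 (LinearEquiv.isUnit_det' A).ne_zero
  set ρ := √(κ / (d * μ)) with hρ
  have hρ0 : 0 < ρ := by positivity
  have hρ2 : ρ ^ 2 * (d * μ) = κ := by
    rw [hρ, Real.sq_sqrt (by positivity)]; field_simp
  refine ⟨ρ, hρ0, fun ξ => ?_⟩
  have m1 := moment_le_of_subset_add hAL.isCompact h1 ξ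
  have m2 := moment_le_of_subset_add (hK.isCompact.smul (1 + δ)) h2 ξ
  rw [moment_smul (by linarith) hK.isCompact] at m2
  rw [moment_image A hL.isCompact, ← hd, hLm, hKm, ← hρ2] at m1 m2
  generalize LinearMap.adjoint (A : ℂ →ₗ[ℝ] ℂ) ξ = y at *
  have hdμ : 0 < d * μ := by positivity
  constructor
  · refine abs_le_of_sq_le_sq' ?_ (norm_nonneg _) |>.2
    refine le_of_mul_le_mul_left ?_ hdμ
    linarith
  · have : ‖y‖ ≤ (1 + δ) ^ 2 * ρ * ‖ξ‖ := by
      refine abs_le_of_sq_le_sq' ?_ (by positivity) |>.2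
      refine le_of_mul_le_mul_left ?_ hdμ
      linarith
    refine this.trans ?_
    gcongr
    nlinarith

/-- Fourier coefficients of nearly equivalent isotropic bodies nearly agree. -/
theorem norm_circleCoeff_le_of_isotropic {K L : Set ℂ} (hK : IsBody K) (hL : IsBody L)
    (iK : IsIsotropic K) (iL : IsIsotropic L) {A : ℂ ≃ₗ[ℝ] ℂ} {v z : ℂ} {δ : ℝ} (hδ : 0 < δ)
    (hδ' : δ ≤ 1 / 40) (h1 : K ⊆ A '' L + {v}) (h2 : A '' L ⊆ (1 + δ) • K + {z}) {m : ℤ}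
    (hm : m ≠ 1) (hm' : m ≠ -1) (hLm : circleCoeff (supp L) m = 0) :
    ‖circleCoeff (supp K) m‖ ≤ 61 * δ * circleMean (supp K) := by
  obtain ⟨ρ, hρ, hA⟩ := iK.exists_scale hK hL iL hδ (by linarith) h1 h2
  set B : ℂ →ₗ[ℝ] ℂ := LinearMap.adjoint (A : ℂ →ₗ[ℝ] ℂ) with hB
  have cB : Continuous B := B.continuous_of_finiteDimensional
  have cK := hK.continuous_supp
  have cL := hL.continuous_supp
  have cLB : Continuous fun ξ => supp L (B ξ) := cL.comp cB
  have s1 : ∀ ξ, supp K ξ ≤ supp L (B ξ) + inner ℝ v ξ :=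
    supp_le_of_subset_image_add hK.nonempty hL.isCompact h1
  have s2 : ∀ ξ, supp L (B ξ) ≤ (1 + δ) * supp K ξ + inner ℝ z ξ :=
    supp_adjoint_le_of_image_subset hK.isCompact hL.nonempty (by linarith) h2
  obtain ⟨O, hO, hOc, hOm⟩ : ∃ O : ℂ → ℂ, (∀ ξ, ‖B ξ - ρ * O ξ‖ ≤ 3 * δ * ρ * ‖ξ‖) ∧
      Continuous O ∧ ∀ j, ‖circleCoeff (fun ξ => supp L (O ξ)) j‖ = ‖circleCoeff (supp L) j‖ := by
    obtain ⟨u, hu, h | h⟩ := exists_orthogonal_near hρ (fun ξ => (hA ξ).1) fun ξ => (hA ξ).2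
    · exact ⟨fun ξ => u * ξ, h, by fun_prop, norm_circleCoeff_comp_mul hu _⟩
    · exact ⟨fun ξ => u * conj ξ, h, by fun_prop, norm_circleCoeff_comp_mul_conj hu _⟩
  have cLO : Continuous fun ξ => supp L (O ξ) := cL.comp hOc
  have near : ∀ j, ‖circleCoeff (fun ξ => supp L (B ξ)) j -
      ρ * circleCoeff (fun ξ => supp L (O ξ)) j‖ ≤ 19 * δ * (ρ * circleMean (supp L)) := by
    intro j
    rw [← circleCoeff_const_mul, ← circleCoeff_sub cLB (by fun_prop)]
    refine (norm_circleCoeff_le (g := fun _ => 3 * δ * ρ * circleMean (supp L)) (by fun_prop)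
      (fun ξ hξ => ?_) j).trans ?_
    · rw [← supp_real_mul L hρ.le]
      refine (abs_supp_sub_le hL.isCompact hL.nonempty (fun x hx => hL.norm_le_circleMean hx)
        _ _).trans ?_
      have := hO ξ
      rw [hξ, mul_one] at this
      rw [mul_comm]
      exact mul_le_mul_of_nonneg_right this hL.circleMean_pos.le
    · rw [circleMean_const]
      have : 0 < δ * (ρ * circleMean (supp L)) := by have := hL.circleMean_pos; positivity
      nlinarith [Real.pi_lt_d2]
  have scale : ρ * circleMean (supp L) ≤ 3 * circleMean (supp K) := by
    have n0 := near 0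
    have hL0 : ‖(ρ : ℂ) * circleCoeff (fun ξ => supp L (O ξ)) 0‖ = ρ * circleMean (supp L) := by
      rw [norm_mul, hOm, circleCoeff_zero, Complex.norm_real, Complex.norm_real,
        Real.norm_of_nonneg hρ.le, Real.norm_of_nonneg hL.circleMean_pos.le]
    have hB0 : ‖circleCoeff (fun ξ => supp L (B ξ)) 0‖ ≤ (1 + δ) * circleMean (supp K) := by
      rw [← circleMean_const_mul, ← circleMean_add_inner (by fun_prop) z]
      refine norm_circleCoeff_le (by fun_prop) (fun ξ _ => ?_) 0
      rw [abs_of_nonneg (hL.supp_nonneg _)]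
      exact s2 ξ
    have tri := norm_le_norm_add_norm_sub (circleCoeff (fun ξ => supp L (B ξ)) 0)
      ((ρ : ℂ) * circleCoeff (fun ξ => supp L (O ξ)) 0)
    rw [hL0] at tri
    have hLp : 0 < ρ * circleMean (supp L) := by have := hL.circleMean_pos; positivity
    have hKp := hK.circleMean_pos
    nlinarith
  have first : ‖circleCoeff (fun ξ => supp L (B ξ)) m - circleCoeff (supp K) m‖ ≤
      δ * circleMean (supp K) := by
    have e : circleCoeff (fun ξ => supp L (B ξ)) m - circleCoeff (supp K) m =
        circleCoeff (fun ξ => supp L (B ξ) + inner ℝ v ξ - supp K ξ) m := by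
      rw [circleCoeff_sub (by fun_prop) cK, circleCoeff_add cLB (by fun_prop), circleCoeff_inner,
        if_neg hm, if_neg hm']
      simp
    rw [e, ← circleMean_const_mul, ← circleMean_add_inner (by fun_prop) (v + z)]
    refine norm_circleCoeff_le (by fun_prop) (fun ξ _ => ?_) m
    rw [abs_of_nonneg (by linarith [s1 ξ]), inner_add_left]
    linarith [s2 ξ]
  have nm := near m
  have hOm0 : circleCoeff (fun ξ => supp L (O ξ)) m = 0 := by
    rw [← norm_eq_zero, hOm, hLm, norm_zero]
  rw [hOm0, mul_zero, sub_zero] at nm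
  have tri := norm_le_norm_add_norm_sub (circleCoeff (fun ξ => supp L (B ξ)) m)
    (circleCoeff (supp K) m)
  have := mul_le_mul_of_nonneg_left scale (by positivity : 0 ≤ 19 * δ)
  have := mul_pos hδ hK.circleMean_pos
  linarith

/-- If the isotropic position of `L` lacks a frequency, it is almost absent from that of the bodies
close to `L`. -/
theorem norm_circleCoeff_isotropicPosition_le {K L : Set ℂ} (hK : IsBody K) (hL : IsBody L)
    {A : ℂ ≃ₗ[ℝ] ℂ} {v z : ℂ} {δ : ℝ} (hδ : 0 < δ) (hδ' : δ ≤ 1 / 40)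
    (h1 : K ⊆ A '' L + {v}) (h2 : A '' L ⊆ (1 + δ) • K + {z}) {m : ℤ}
    (hm : m ≠ 1) (hm' : m ≠ -1) (hLm : circleCoeff (supp (isotropicPosition L)) m = 0) :
    ‖circleCoeff (supp (isotropicPosition K)) m‖ ≤
      61 * δ * circleMean (supp (isotropicPosition K)) := by
  have eK : isotropicPosition K = normEquiv K hK '' K := rfl
  have eL : isotropicPosition L = normEquiv L hL '' L := rfl
  have e : ((normEquiv L hL).symm.trans (A.trans (normEquiv K hK))) '' isotropicPosition L =
      normEquiv K hK '' (A '' L) := by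
    simp [eL, image_image]
  refine norm_circleCoeff_le_of_isotropic (v := normEquiv K hK v) (z := normEquiv K hK z)
    (A := (normEquiv L hL).symm.trans (A.trans (normEquiv K hK))) hK.isBody_isotropicPosition
    hL.isBody_isotropicPosition hK.isIsotropic_isotropicPosition
    hL.isIsotropic_isotropicPosition hδ hδ' ?_ ?_ hm hm' hLm
  · rw [e, eK, ← image_singleton, ← image_add]
    exact image_mono h1
  · rw [e, eK, ← image_smul_set, ← image_singleton, ← image_add]
    exact image_mono h2

end Stability

section ContinuousFamily

open Complex ComplexConjugate Filter Topology

/-- Continuity of a family of sets in the multiplicative sense. -/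
def IsContinuousFamily (K : ℂ → Set ℂ) : Prop :=
  ∀ w₀, ∀ η : ℝ, 0 < η → ∀ᶠ w in 𝓝 w₀, K w ⊆ (1 + η) • K w₀ ∧ K w₀ ⊆ (1 + η) • K w

theorem continuous_of_le_pow_mul {f : ℂ → ℝ} (k : ℕ)
    (h : ∀ w₀, ∀ η : ℝ, 0 < η →
      ∀ᶠ w in 𝓝 w₀, f w ≤ (1 + η) ^ k * f w₀ ∧ f w₀ ≤ (1 + η) ^ k * f w) : Continuous f := by
  rw [continuous_iff_continuousAt]
  intro w₀
  have lim : ∀ c : ℝ, Tendsto (fun η : ℝ => (1 + η) ^ k * c) (𝓝[>] 0) (𝓝 c) := by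
    intro c
    have : Continuous fun η : ℝ => (1 + η) ^ k * c := by fun_prop
    simpa using (this.tendsto 0).mono_left nhdsWithin_le_nhds
  refine tendsto_order.2 ⟨fun a ha => ?_, fun b hb => ?_⟩
  · obtain ⟨η, h1, h2⟩ := (((lim a).eventually_lt_const ha).and self_mem_nhdsWithin).exists
    filter_upwards [h w₀ η h2] with w hw
    have : (0 : ℝ) < (1 + η) ^ k := by have : (0 : ℝ) < η := h2; positivity
    exact lt_of_mul_lt_mul_left (h1.trans_le hw.2) this.le
  · obtain ⟨η, h1, h2⟩ := (((lim (f w₀)).eventually_lt_const hb).and self_mem_nhdsWithin).exists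
    filter_upwards [h w₀ η h2] with w hw
    exact hw.1.trans_lt h1

theorem supp_le_of_subset_smul {K L : Set ℂ} (hK : IsBody K) (hL : IsBody L) {c : ℝ} (hc : 0 ≤ c)
    (h : K ⊆ c • L) (ξ : ℂ) : supp K ξ ≤ c * supp L ξ := by
  refine supp_le hK.nonempty fun x hx => ?_
  obtain ⟨y, hy, rfl⟩ := h hx
  rw [real_inner_smul_left]
  gcongr
  exact inner_le_supp hL.isCompact hy ξ

variable {K : ℂ → Set ℂ}

theorem IsContinuousFamily.continuous_moment (h : IsContinuousFamily K) (hK : ∀ w, IsBody (K w))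
    (ξ : ℂ) : Continuous fun w => moment (K w) ξ := by
  have le {w w' : ℂ} {η : ℝ} (hη : 0 < η) (hs : K w ⊆ (1 + η) • K w') :
      moment (K w) ξ ≤ (1 + η) ^ 4 * moment (K w') ξ := by
    rw [← moment_smul (by linarith) (hK w').isCompact]
    exact moment_mono ((hK w').isCompact.smul _) hs ξ
  refine continuous_of_le_pow_mul 4 fun w₀ η hη => ?_
  filter_upwards [h w₀ η hη] with w hw
  exact ⟨le hη hw.1, le hη hw.2⟩

theorem IsContinuousFamily.continuous_supp_apply (h : IsContinuousFamily K)
    (hK : ∀ w, IsBody (K w)) (ξ : ℂ) : Continuous fun w => supp (K w) ξ := by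
  refine continuous_of_le_pow_mul 1 fun w₀ η hη => ?_
  filter_upwards [h w₀ η hη] with w hw
  rw [pow_one]
  exact ⟨supp_le_of_subset_smul (hK _) (hK _) (by linarith) hw.1 ξ,
    supp_le_of_subset_smul (hK _) (hK _) (by linarith) hw.2 ξ⟩

theorem IsContinuousFamily.continuous_supp (h : IsContinuousFamily K) (hK : ∀ w, IsBody (K w)) :
    Continuous fun p : ℂ × ℂ => supp (K p.1) p.2 := by
  rw [continuous_iff_continuousAt]
  rintro ⟨w₀, ξ₀⟩
  obtain ⟨R, hR⟩ := (hK w₀).isCompact.isBounded.exists_norm_le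
  have t1 : Tendsto (fun p : ℂ × ℂ => supp (K p.1) p.2 - supp (K p.1) ξ₀) (𝓝 (w₀, ξ₀)) (𝓝 0) := by
    have t2 : Tendsto (fun p : ℂ × ℂ => (1 + 1) * R * ‖p.2 - ξ₀‖) (𝓝 (w₀, ξ₀)) (𝓝 0) := by
      have : Continuous fun p : ℂ × ℂ => (1 + 1) * R * ‖p.2 - ξ₀‖ := by fun_prop
      simpa using this.tendsto (w₀, ξ₀)
    refine squeeze_zero_norm' ?_ t2
    filter_upwards [(continuous_fst.tendsto (w₀, ξ₀)).eventually (h w₀ 1 one_pos)] with p hp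
    refine abs_supp_sub_le (hK _).isCompact (hK _).nonempty (fun x hx => ?_) _ _
    obtain ⟨y, hy, rfl⟩ := hp.1 hx
    simp only [norm_smul, Real.norm_eq_abs]
    rw [abs_of_pos (by norm_num)]
    gcongr
    exact hR y hy
  have t3 := ((h.continuous_supp_apply hK ξ₀).comp continuous_fst).tendsto (w₀, ξ₀)
  have := t1.add t3
  simpa [ContinuousAt] using this

theorem IsContinuousFamily.continuous_circleCoeff (h : IsContinuousFamily K)
    (hK : ∀ w, IsBody (K w)) (m : ℤ) :
    Continuous fun w => circleCoeff (supp (isotropicPosition (K w))) m := by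
  have hm := h.continuous_moment hK
  have hP : Continuous fun w => momentP (K w) := by
    have h1 := hm 1; have h2 := hm I
    unfold momentP; fun_prop
  have hQ : Continuous fun w => momentQ (K w) := by
    have h1 := hm 1; have h2 := hm I; have h3 := hm (1 + I)
    have e : (fun w => momentQ (K w)) = fun w =>
        (((moment (K w) 1 - moment (K w) I) / 2 : ℝ) : ℂ) +
          (((moment (K w) (1 + I) - moment (K w) 1 - moment (K w) I) / 2 : ℝ) : ℂ) * I := by
      ext w; exact Complex.mk_eq_add_mul_I _ _
    rw [e]; fun_prop
  have hA : Continuous fun w => normA (K w) := by unfold normA; fun_prop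
  unfold circleCoeff
  refine intervalIntegral.continuous_parametric_intervalIntegral_of_continuous' ?_ _ _
  have hs := h.continuous_supp hK
  have hA' : Continuous fun p : ℂ × ℝ => normA (K p.1) := hA.comp continuous_fst
  have hQ' : Continuous fun p : ℂ × ℝ => momentQ (K p.1) := hQ.comp continuous_fst
  simp only [supp_isotropicPosition, normMap_apply]
  have : Continuous fun p : ℂ × ℝ => supp (K p.1) (normA (K p.1) * cexp (p.2 * I) -
      momentQ (K p.1) * conj (cexp (p.2 * I))) :=
    hs.comp (f := fun p : ℂ × ℝ => (p.1, normA (K p.1) * cexp (p.2 * I) -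
      momentQ (K p.1) * conj (cexp (p.2 * I)))) (by fun_prop)
  fun_prop

end ContinuousFamily

section Rotation

open Complex ComplexConjugate

theorem momentP_momentQ_unique {K : Set ℂ} {p : ℝ} {q : ℂ}
    (h : ∀ ξ, moment K ξ = p * ‖ξ‖ ^ 2 + (q * conj ξ ^ 2).re) :
    momentP K = p ∧ momentQ K = q := by
  have hn : ‖1 + I‖ ^ 2 = 2 := by
    rw [← Complex.normSq_eq_norm_sq, Complex.normSq_apply]; norm_num
  constructor
  · rw [momentP, h, h]; simp; ring
  · apply Complex.ext
    · simp only [momentQ, h]; simp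
    · simp only [momentQ, h, hn]
      simp [pow_two]
      ring

theorem adjoint_rotation (a : Circle) (ξ : ℂ) :
    LinearMap.adjoint ((rotation a).toLinearEquiv : ℂ →ₗ[ℝ] ℂ) ξ = conj (a : ℂ) * ξ := by
  have : LinearMap.mulLeft ℝ (conj (a : ℂ)) =
      LinearMap.adjoint ((rotation a).toLinearEquiv : ℂ →ₗ[ℝ] ℂ) := by
    rw [LinearMap.eq_adjoint_iff]
    intro x y
    simp [Complex.inner]
    ring
  rw [← this]; rfl

/-- Passing to isotropic position commutes with rotations. -/
theorem supp_isotropicPosition_rotation (a : Circle) {K : Set ℂ} (hK : IsCompact K) (ξ : ℂ) :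
    supp (isotropicPosition (rotation a '' K)) ξ = supp (isotropicPosition K) (conj (a : ℂ) * ξ) := by
  have hm : ∀ ξ, moment (rotation a '' K) ξ = moment K (conj (a : ℂ) * ξ) := by
    intro ξ
    have := moment_image (rotation a).toLinearEquiv hK ξ
    rw [adjoint_rotation, det_rotation] at this
    simpa using this
  obtain ⟨hP, hQ⟩ := momentP_momentQ_unique (K := rotation a '' K) (p := momentP K)
    (q := (a : ℂ) ^ 2 * momentQ K) (by
      intro ξ
      rw [hm, moment_eq hK, norm_mul, RCLike.norm_conj, Circle.norm_coe, one_mul, map_mul,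
        Complex.conj_conj]
      ring_nf)
  have hN : normA (rotation a '' K) = normA K := by
    rw [normA, hP, hQ, norm_mul, norm_pow, Circle.norm_coe, one_pow, one_mul, normA]
  have ha : conj (a : ℂ) * a = 1 := by
    rw [← Complex.normSq_eq_conj_mul_self, Circle.normSq_coe, ofReal_one]
  have hs := supp_image ((rotation a).toLinearEquiv : ℂ →ₗ[ℝ] ℂ) K
  change ∀ ξ, supp (rotation a '' K) ξ = _ at hs
  rw [supp_isotropicPosition, supp_isotropicPosition, hs, adjoint_rotation, normMap_apply,
    normMap_apply, hN, hQ, map_mul, Complex.conj_conj]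
  congr 1
  linear_combination -(a * momentQ K * conj ξ) * ha

end Rotation

section Vanishing

open Complex ComplexConjugate Filter Topology

variable {V : Type*} [NormedAddCommGroup V] [NormedSpace ℝ V]

theorem mem_smul_of_norm_sub_le {K : Set V} (hK : Convex ℝ K) {r η : ℝ} (hη : 0 < η)
    (hr : closedBall 0 r ⊆ K) {x y : V} (hx : x ∈ K) (hxy : ‖y - x‖ ≤ η * r) :
    y ∈ (1 + η) • K := by
  rw [hK.add_smul zero_le_one hη.le, one_smul]
  refine ⟨x, hx, y - x, ⟨η⁻¹ • (y - x), hr ?_, ?_⟩, by simp⟩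
  · rw [mem_closedBall_zero_iff, norm_smul, norm_inv, Real.norm_of_nonneg hη.le,
      inv_mul_le_iff₀ hη]
    exact hxy
  · simp [smul_smul, hη.ne']

theorem isBody_preimage {K : Set V} (hK : IsCompact K) (hc : Convex ℝ K) (h0 : 0 ∈ interior K)
    {φ : ℂ →L[ℝ] V} (hφ : Function.Injective φ) : IsBody (φ ⁻¹' K) where
  isCompact := (LinearMap.isClosedEmbedding_of_injective (f := (φ : ℂ →ₗ[ℝ] V))
    (LinearMap.ker_eq_bot.2 hφ)).isCompact_preimage hK
  convex := hc.linear_preimage (φ : ℂ →ₗ[ℝ] V)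
  zero_mem_interior := preimage_interior_subset_interior_preimage φ.continuous (by simpa using h0)

theorem isContinuousFamily_preimage {K : Set V} (hK : IsCompact K) (hc : Convex ℝ K)
    (h0 : 0 ∈ interior K) {Φ : ℂ → ℂ →L[ℝ] V} (hΦ : Continuous Φ)
    (hinj : ∀ w, Function.Injective (Φ w)) : IsContinuousFamily fun w => Φ w ⁻¹' K := by
  intro w₀ η hη
  obtain ⟨r, hr, hrK⟩ := Metric.nhds_basis_closedBall.mem_iff.1 (mem_interior_iff_mem_nhds.1 h0)
  obtain ⟨R, hR⟩ := hK.isBounded.exists_norm_le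
  have hR0 : 0 ≤ R := by simpa using hR 0 (interior_subset h0)
  obtain ⟨c, hc0, hcl⟩ := (LinearMap.injective_iff_antilipschitz (Φ w₀ : ℂ →ₗ[ℝ] V)).1 (hinj w₀)
  have hbd : ∀ z, ‖z‖ ≤ c * ‖Φ w₀ z‖ := fun z => by
    simpa using hcl.le_mul_dist z 0
  have hc0' : (0 : ℝ) < c := hc0
  have h2 : Tendsto (fun w => ‖Φ w - Φ w₀‖) (𝓝 w₀) (𝓝 0) := by
    have : Continuous fun w => ‖Φ w - Φ w₀‖ := by fun_prop
    simpa using this.tendsto w₀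
  filter_upwards [h2.eventually_lt_const (show 0 < 1 / (2 * (c : ℝ)) by positivity),
    h2.eventually_lt_const (show 0 < η * r / (2 * c * (R + 1)) by positivity)] with w hw1 hw2
  rw [lt_div_iff₀ (by positivity)] at hw1 hw2
  have hdiff : ∀ z, ‖Φ w z - Φ w₀ z‖ ≤ ‖Φ w - Φ w₀‖ * ‖z‖ := fun z => (Φ w - Φ w₀).le_opNorm z
  have small : ∀ z, ‖z‖ ≤ 2 * c * R → ‖Φ w z - Φ w₀ z‖ ≤ η * r := by
    intro z hz
    refine (hdiff z).trans ((mul_le_mul_of_nonneg_left hz (norm_nonneg _)).trans ?_)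
    nlinarith [norm_nonneg (Φ w - Φ w₀)]
  have lin : ∀ φ : ℂ →L[ℝ] V, (1 + η) • (φ ⁻¹' K) = φ ⁻¹' ((1 + η) • K) := by
    intro φ
    ext z
    rw [mem_preimage, mem_smul_set_iff_inv_smul_mem₀ (by positivity),
      mem_smul_set_iff_inv_smul_mem₀ (by positivity), mem_preimage, map_smul]
  rw [lin, lin]
  constructor
  · intro z hz
    refine mem_smul_of_norm_sub_le hc hη hrK hz ?_
    rw [norm_sub_rev]
    refine small z ?_
    have h3 := hbd z
    have h4 := norm_le_norm_add_norm_sub (Φ w z) (Φ w₀ z)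
    have h5 := hR _ hz
    have h6 := hdiff z
    have h7 := mul_le_mul_of_nonneg_left (h4.trans (add_le_add h5 h6)) hc0'.le
    have h8 := mul_le_mul_of_nonneg_right hw1.le (norm_nonneg z)
    linarith
  · intro z hz
    refine mem_smul_of_norm_sub_le hc hη hrK hz (small z ?_)
    have h3 := hbd z
    have h5 := mul_le_mul_of_nonneg_left (hR _ hz) hc0'.le
    nlinarith

/-- In a suitable family of planar sections, every nonzero frequency of the isotropic position
vanishes for some section. -/
theorem exists_circleCoeff_eq_zero {K : Set V} (hK : IsCompact K) (hc : Convex ℝ K)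
    (h0 : 0 ∈ interior K) {Φ : ℂ → ℂ →L[ℝ] V} (hΦ : Continuous Φ)
    (hinj : ∀ w, Function.Injective (Φ w))
    (hrot : ∀ w, ‖w‖ = 1 → ∀ z, Φ w z = Φ 1 (w ^ 2 * z)) {m : ℤ} (hm : m ≠ 0) :
    ∃ w, circleCoeff (supp (isotropicPosition (Φ w ⁻¹' K))) m = 0 := by
  have hb : ∀ w, IsBody (Φ w ⁻¹' K) := fun w => isBody_preimage hK hc h0 (hinj w)
  refine exists_zero_of_winding
    ((isContinuousFamily_preimage hK hc h0 hΦ hinj).continuous_circleCoeff hb m)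
    (k := -2 * m) (by simpa using hm) fun θ => ?_
  have hrotK : Φ 1 ⁻¹' K = rotation (Circle.exp (2 * θ)) '' (Φ (cexp (θ * I)) ⁻¹' K) := by
    ext z
    have hz : z = rotation (Circle.exp (2 * θ)) (cexp (-(2 * θ * I)) * z) := by
      rw [rotation_apply, Circle.coe_exp, ← mul_assoc, ← Complex.exp_add]
      push_cast; simp
    have hw : ∀ y, Φ (cexp (θ * I)) y = Φ 1 (rotation (Circle.exp (2 * θ)) y) := by
      intro y
      rw [hrot _ (Complex.norm_exp_ofReal_mul_I θ), rotation_apply, Circle.coe_exp,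
        ← Complex.exp_nat_mul]
      push_cast; ring_nf
    constructor
    · intro h
      refine ⟨cexp (-(2 * θ * I)) * z, ?_, hz.symm⟩
      rw [mem_preimage, hw, ← hz]; exact h
    · rintro ⟨y, hy, rfl⟩
      rw [mem_preimage, hw] at hy; exact hy
  have e : supp (isotropicPosition (Φ (cexp (θ * I)) ⁻¹' K)) =
      fun ξ => supp (isotropicPosition (Φ 1 ⁻¹' K)) (cexp ((2 * θ : ℝ) * I) * ξ) := by
    ext ξ
    rw [hrotK, supp_isotropicPosition_rotation _ (hb _).isCompact, ← mul_assoc]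
    have : conj ((Circle.exp (2 * θ) : Circle) : ℂ) * cexp ((2 * θ : ℝ) * I) = 1 := by
      rw [← Circle.coe_exp, ← Complex.normSq_eq_conj_mul_self, Circle.normSq_coe, ofReal_one]
    rw [this, one_mul]
  rw [e, circleCoeff_comp_mul]
  push_cast; ring_nf

end Vanishing

section NearDisc

open Complex ComplexConjugate

/-- A body whose support function has small higher frequencies has an almost constant support
function, up to a translation. -/
theorem IsBody.exists_abs_supp_sub_le {K : Set ℂ} (hK : IsBody K) {η : ℝ} (hη : 0 < η)
    (hη' : η ≤ 1) (hc : ∀ m : ℤ, m ≠ 0 → m ≠ 1 → m ≠ -1 →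
      ‖circleCoeff (supp K) m‖ ≤ 61 * η ^ 3 * circleMean (supp K)) :
    ∃ (v : ℂ) (r : ℝ), 0 < r ∧
      ∀ ξ, ‖ξ‖ = 1 → |supp K ξ - r - inner ℝ v ξ| ≤ 810 * η * r := by
  have cK := hK.continuous_supp
  set μ := circleMean (supp K) with hμ
  have hμ0 : 0 < μ := hK.circleMean_pos
  have hπ := Real.pi_pos
  have hπ' : (Real.pi : ℂ) ≠ 0 := by exact_mod_cast hπ.ne'
  set v : ℂ := circleCoeff (supp K) 1 / Real.pi with hv
  have hvμ : ‖v‖ ≤ μ := by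
    have : ‖circleCoeff (supp K) 1‖ ≤ μ :=
      norm_circleCoeff_le cK (fun ξ _ => (abs_of_nonneg (hK.supp_nonneg ξ)).le) 1
    rw [hv, norm_div, Complex.norm_real, Real.norm_of_nonneg hπ.le, div_le_iff₀ hπ]
    nlinarith [Real.pi_gt_three]
  have coeff : ∀ m : ℤ, circleCoeff (fun ξ => supp K ξ - μ / (2 * Real.pi) - inner ℝ v ξ) m =
      circleCoeff (supp K) m - ((if m = 0 then μ else 0 : ℝ) : ℂ) -
        ((if m = -1 then Real.pi * conj v else 0) + if m = 1 then Real.pi * v else 0) := by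
    intro m
    rw [circleCoeff_sub (by fun_prop) (by fun_prop), circleCoeff_sub cK (by fun_prop),
      circleCoeff_const, circleCoeff_inner]
    congr 4
    field_simp
  have h1 : circleCoeff (supp K) 1 = Real.pi * v := by rw [hv]; field_simp
  have hB : ∀ m, ‖circleCoeff (fun ξ => supp K ξ - μ / (2 * Real.pi) - inner ℝ v ξ) m‖ ≤
      61 * η ^ 3 * μ := by
    intro m
    have hpos : 0 ≤ 61 * η ^ 3 * μ := by positivity
    rw [coeff]
    by_cases m0 : m = 0
    · subst m0; simpa [circleCoeff_zero, ← hμ] using hpos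
    by_cases m1 : m = 1
    · subst m1; simpa [h1] using hpos
    by_cases m2 : m = -1
    · subst m2
      rw [circleCoeff_neg, h1]
      simpa using hpos
    · simpa [m0, m1, m2] using hc m m0 m1 m2
  have hlip : ∀ x t : ℝ, |supp K (cexp (x * I)) - μ / (2 * Real.pi) - inner ℝ v (cexp (x * I)) -
      (supp K (cexp (t * I)) - μ / (2 * Real.pi) - inner ℝ v (cexp (t * I)))| ≤
      2 * μ * ‖cexp (x * I) - cexp (t * I)‖ := by
    intro x t
    have h2 := abs_supp_sub_le hK.isCompact hK.nonempty (fun x hx => hK.norm_le_circleMean hx)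
      (cexp (x * I)) (cexp (t * I))
    have h3 := (abs_real_inner_le_norm v (cexp (x * I) - cexp (t * I))).trans
      (mul_le_mul_of_nonneg_right hvμ (norm_nonneg _))
    rw [inner_sub_right] at h3
    rw [abs_le] at h2 h3 ⊢
    constructor <;> linarith [h2.1, h2.2, h3.1, h3.2]
  have hM : 1 ≤ (⌈(η ^ 2)⁻¹⌉₊ : ℝ) * η ^ 2 := by
    have h4 := mul_le_mul_of_nonneg_right (Nat.le_ceil (η ^ 2)⁻¹) (sq_nonneg η)
    rwa [inv_mul_cancel₀ (by positivity)] at h4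
  have hM' : (⌈(η ^ 2)⁻¹⌉₊ : ℝ) * η ^ 3 ≤ 2 * η := by
    have h4 := mul_le_mul_of_nonneg_right (Nat.ceil_lt_add_one (a := (η ^ 2)⁻¹)
      (by positivity)).le (by positivity : 0 ≤ η ^ 3)
    have h5 : ((η ^ 2)⁻¹ + 1) * η ^ 3 = η + η ^ 3 := by field_simp
    rw [h5] at h4
    have h6 : η ^ 2 ≤ 1 := pow_le_one₀ hη.le hη'
    nlinarith
  refine ⟨v, μ / (2 * Real.pi), by positivity, fun ξ hξ => ?_⟩
  obtain ⟨x, rfl⟩ : ∃ x : ℝ, cexp (x * I) = ξ := by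
    refine ⟨ξ.arg, ?_⟩
    have := Complex.norm_mul_exp_arg_mul_I ξ
    rwa [hξ, ofReal_one, one_mul] at this
  have key := abs_le_of_circleCoeff_le (h := fun ξ => supp K ξ - μ / (2 * Real.pi) - inner ℝ v ξ)
    (by fun_prop) (by positivity) hlip hB hη hM x
  refine key.trans ?_
  have h7 : (⌈(η ^ 2)⁻¹⌉₊ : ℝ) * (61 * η ^ 3 * μ) ≤ 61 * (2 * η) * μ := by
    have := mul_le_mul_of_nonneg_right hM' (by positivity : 0 ≤ 61 * μ)
    linarith
  have h8 : 128 * η * μ ≤ 810 * η * (μ / (2 * Real.pi)) := by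
    rw [mul_div_assoc', le_div_iff₀ (by positivity)]
    have : 0 < η * μ := by positivity
    nlinarith [Real.pi_lt_d2]
  linarith

theorem IsBody.subset_closedBall_of_supp_le {K : Set ℂ} (hK : IsBody K) {v : ℂ} {R : ℝ}
    (hR : 0 ≤ R) (h : ∀ ξ, ‖ξ‖ = 1 → supp K ξ ≤ R + inner ℝ v ξ) : K ⊆ closedBall v R := by
  intro x hx
  rw [mem_closedBall_iff_norm]
  rcases eq_or_ne (x - v) 0 with h0 | h0
  · rw [h0, norm_zero]; exact hR
  have hn : ‖(‖x - v‖⁻¹ : ℝ) • (x - v)‖ = 1 := by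
    rw [norm_smul, norm_inv, norm_norm, inv_mul_cancel₀ (norm_ne_zero_iff.2 h0)]
  have h1 := (inner_le_supp hK.isCompact hx _).trans (h _ hn)
  have h2 : inner ℝ (x - v) ((‖x - v‖⁻¹ : ℝ) • (x - v)) = ‖x - v‖ := by
    rw [real_inner_smul_right, real_inner_self_eq_norm_sq]
    field_simp [norm_ne_zero_iff.2 h0]
  rw [inner_sub_left] at h2
  linarith

theorem IsBody.closedBall_subset_of_le_supp {K : Set ℂ} (hK : IsBody K) {v : ℂ} {r : ℝ}
    (h : ∀ ξ, ‖ξ‖ = 1 → r + inner ℝ v ξ ≤ supp K ξ) : closedBall v r ⊆ K := by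
  intro y hy
  by_contra hyK
  obtain ⟨f, u, hf, hu⟩ := geometric_hahn_banach_closed_point hK.convex hK.isCompact.isClosed hyK
  obtain ⟨w, rfl⟩ := (InnerProductSpace.toDual ℝ ℂ).surjective f
  simp only [InnerProductSpace.toDual_apply_apply] at hf hu
  have hs : supp K w ≤ u := supp_le hK.nonempty fun x hx => by
    rw [real_inner_comm]; exact (hf x hx).le
  have hw : w ≠ 0 := by
    rintro rfl
    have := hf 0 hK.zero_mem
    simp only [inner_zero_left] at this hu
    linarith
  have hw0 : 0 < ‖w‖ := norm_pos_iff.2 hw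
  have hn : ‖(‖w‖⁻¹ : ℝ) • w‖ = 1 := by
    rw [norm_smul, norm_inv, norm_norm, inv_mul_cancel₀ hw0.ne']
  have h1 := mul_le_mul_of_nonneg_left (h _ hn) hw0.le
  rw [← supp_real_mul K hw0.le, ← Complex.real_smul, smul_smul, mul_inv_cancel₀ hw0.ne', one_smul,
    mul_add, ← real_inner_smul_right, smul_smul, mul_inv_cancel₀ hw0.ne', one_smul] at h1
  have h2 := real_inner_le_norm (y - v) w
  have h3 := mul_le_mul_of_nonneg_right (mem_closedBall_iff_norm.1 hy) hw0.le
  rw [inner_sub_left] at h2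
  rw [real_inner_comm] at hu
  linarith

end NearDisc

section LargestTriangle

open Complex ComplexConjugate

/-- Every planar body lies, up to a linear map, between two concentric discs of bounded ratio. -/
theorem IsBody.exists_closedBall_subset {K : Set ℂ} (hK : IsBody K) :
    ∃ (S : ℂ ≃ₗ[ℝ] ℂ) (v : ℂ) (r : ℝ), 0 < r ∧ closedBall v r ⊆ S ⁻¹' K ∧
      S ⁻¹' K ⊆ closedBall v (10 * r) := by
  let D : ℂ → ℂ → ℝ := fun a b => a.re * b.im - a.im * b.re
  have cD : Continuous fun p : ℂ × ℂ × ℂ => |D (p.2.1 - p.1) (p.2.2 - p.1)| := by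
    simp only [D]; fun_prop
  obtain ⟨⟨x, y, z⟩, ⟨hx, hy, hz⟩, hmax⟩ :=
    (hK.isCompact.prod (hK.isCompact.prod hK.isCompact)).exists_isMaxOn
      ⟨(0, 0, 0), hK.zero_mem, hK.zero_mem, hK.zero_mem⟩ cD.continuousOn
  have hmaximal : ∀ p q s, p ∈ K → q ∈ K → s ∈ K → |D (q - p) (s - p)| ≤ |D (y - x) (z - x)| :=
    fun p q s hp hq hs => hmax (show (p, q, s) ∈ K ×ˢ K ×ˢ K from ⟨hp, hq, hs⟩)
  have hD : D (y - x) (z - x) ≠ 0 := by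
    intro h0
    obtain ⟨ρ, hρ, hball⟩ := Metric.nhds_basis_closedBall.mem_iff.1
      (mem_interior_iff_mem_nhds.1 hK.zero_mem_interior)
    have h1 := hmaximal 0 ρ (ρ * I) hK.zero_mem (hball (by simp [abs_of_pos hρ]))
      (hball (by simp [abs_of_pos hρ]))
    rw [h0] at h1
    simp only [D, sub_zero, abs_zero] at h1
    simp at h1
    nlinarith
  set a := y - x with ha
  set b := z - x with hb
  let T : ℂ →ₗ[ℝ] ℂ := reLm.smulRight a + imLm.smulRight b
  have hT : ∀ ζ, T ζ = ζ.re * a + ζ.im * b := fun ζ => by simp [T]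
  have hTb : ∀ ζ, D (T ζ) b = ζ.re * D a b := fun ζ => by
    rw [hT]; simp [D]; ring
  have hTa : ∀ ζ, D a (T ζ) = ζ.im * D a b := fun ζ => by
    rw [hT]; simp [D]; ring
  have hinj : Function.Injective T := by
    rw [injective_iff_map_eq_zero]
    intro ζ hζ
    have h1 := hTb ζ
    have h2 := hTa ζ
    rw [hζ] at h1 h2
    simp only [D, zero_re, zero_im, zero_mul, mul_zero, sub_zero] at h1 h2
    exact Complex.ext ((mul_eq_zero.1 h1.symm).resolve_right hD)
      ((mul_eq_zero.1 h2.symm).resolve_right hD)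
  let S := LinearEquiv.ofInjectiveEndo T hinj
  obtain ⟨ξ, hξ⟩ := S.surjective x
  have hξ : T ξ = x := hξ
  have hS : S ⁻¹' K = T ⁻¹' K := rfl
  refine ⟨S, ξ + (1 / 3 + 1 / 3 * I), 1 / 5, by norm_num, fun ζ hζ => ?_, fun ζ hζ => ?_⟩
  · rw [hS, mem_preimage]
    rw [mem_closedBall_iff_norm, ← abs_of_pos (show (0 : ℝ) < 1 / 5 by norm_num), ← abs_norm,
      ← sq_le_sq, ← Complex.normSq_eq_norm_sq, Complex.normSq_apply] at hζ
    simp at hζ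
    set s := ζ.re - ξ.re with hs
    set t := ζ.im - ξ.im with ht
    have hst : (s - 1 / 3) ^ 2 + (t - 1 / 3) ^ 2 ≤ 1 / 25 := by
      rw [hs, ht]; linarith
    have e : T ζ = (1 - s - t) • x + s • y + t • z := by
      rw [← hξ] at ha hb
      have h1 := hT ζ
      have h2 := hT ξ
      have hy : y = a + T ξ := by rw [ha]; ring
      have hz : z = b + T ξ := by rw [hb]; ring
      simp only [Complex.real_smul]
      rw [hy, hz, ← hξ, h1, h2, hs, ht]
      push_cast
      ring
    rw [e]
    have hsum := hK.convex.sum_mem (t := Finset.univ) (w := ![1 - s - t, s, t]) (z := ![x, y, z])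
      (by
        intro i _
        fin_cases i
        · simp; nlinarith [sq_nonneg (s - t)]
        · simp; nlinarith [sq_nonneg (t - 1 / 3)]
        · simp; nlinarith [sq_nonneg (s - 1 / 3)])
      (by simp [Fin.sum_univ_three]; ring)
      (by
        intro i _
        fin_cases i
        exacts [hx, hy, hz])
    simpa [Fin.sum_univ_three] using hsum
  · rw [hS, mem_preimage] at hζ
    have h1 := hmaximal x (T ζ) z hx hζ hz
    have h2 := hmaximal x y (T ζ) hx hy hζ
    rw [← hξ, ← map_sub, hξ] at h1 h2
    rw [← ha, ← hb] at *
    rw [hTb, abs_mul] at h1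
    rw [hTa, abs_mul] at h2
    have hD' := abs_pos.2 hD
    have h1 := abs_le.1 (le_of_mul_le_mul_right (h1.trans_eq (one_mul _).symm) hD')
    have h2 := abs_le.1 (le_of_mul_le_mul_right (h2.trans_eq (one_mul _).symm) hD')
    rw [mem_closedBall_iff_norm, ← abs_of_pos (show (0 : ℝ) < 10 * (1 / 5) by norm_num),
      ← abs_norm, ← sq_le_sq, ← Complex.normSq_eq_norm_sq, Complex.normSq_apply]
    simp at h1 h2 ⊢
    nlinarith [h1.1, h1.2, h2.1, h2.2]

end LargestTriangle

section SectionFamily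

open Complex ComplexConjugate

variable {V : Type*} [NormedAddCommGroup V] [NormedSpace ℝ V]

/-- A family of planar embeddings, indexed by the plane, that turns twice around the plane of `φ`
along the unit circle. -/
noncomputable def sectionFamily (φ : ℂ →L[ℝ] V) (e : V) (w : ℂ) : ℂ →L[ℝ] V :=
  φ.comp (ContinuousLinearMap.mul ℝ ℂ (w ^ 2) - (1 - ‖w‖ ^ 2) • (conjCLE : ℂ →L[ℝ] ℂ)) +
    ((1 - ‖w‖ ^ 2) • reCLM.comp (ContinuousLinearMap.mul ℝ ℂ w)).smulRight e

theorem sectionFamily_apply (φ : ℂ →L[ℝ] V) (e : V) (w z : ℂ) :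
    sectionFamily φ e w z = φ (w ^ 2 * z - (1 - ‖w‖ ^ 2 : ℝ) * conj z) +
      ((1 - ‖w‖ ^ 2) * (w * z).re) • e := by
  simp only [sectionFamily, add_apply, ContinuousLinearMap.comp_apply, sub_apply, smul_apply,
    ContinuousLinearMap.mul_apply', ContinuousLinearMap.smulRight_apply, reCLM_apply, smul_eq_mul,
    ContinuousLinearEquiv.coe_coe, conjCLE_apply, Complex.real_smul]

theorem sectionFamily_one (φ : ℂ →L[ℝ] V) (e : V) : sectionFamily φ e 1 = φ := by
  ext z
  simp [sectionFamily_apply]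

theorem continuous_sectionFamily (φ : ℂ →L[ℝ] V) (e : V) : Continuous (sectionFamily φ e) := by
  rw [continuous_clm_apply]
  intro z
  simp only [sectionFamily_apply]
  fun_prop

theorem sectionFamily_injective {φ : ℂ →L[ℝ] V} (hφ : Function.Injective φ) {e : V}
    (he : e ∉ range φ) (w : ℂ) : Function.Injective (sectionFamily φ e w) := by
  rw [injective_iff_map_eq_zero]
  intro z hz
  rw [sectionFamily_apply] at hz
  have h1 : (1 - ‖w‖ ^ 2) * (w * z).re = 0 := by
    by_contra h
    refine he ⟨((1 - ‖w‖ ^ 2) * (w * z).re)⁻¹ • -(w ^ 2 * z - (1 - ‖w‖ ^ 2 : ℝ) * conj z), ?_⟩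
    rw [map_smul, map_neg, ← eq_neg_of_add_eq_zero_right hz, smul_smul, inv_mul_cancel₀ h, one_smul]
  rw [h1, zero_smul, add_zero, map_eq_zero_iff φ hφ, sub_eq_zero] at hz
  rcases mul_eq_zero.1 h1 with h2 | h2
  · rw [h2, ofReal_zero, zero_mul, mul_eq_zero] at hz
    refine hz.resolve_left fun h3 => ?_
    rw [eq_zero_of_pow_eq_zero h3] at h2
    simp at h2
  · have h3 : (w * z) ^ 2 = ((1 - ‖w‖ ^ 2) * ‖z‖ ^ 2 : ℝ) := by
      rw [ofReal_mul, ← Complex.normSq_eq_norm_sq z, ← Complex.mul_conj]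
      linear_combination z * hz
    have h4 := congrArg re h3
    have h5 : ‖w * z‖ ^ 2 = (w * z).im ^ 2 := by
      rw [← Complex.normSq_eq_norm_sq, Complex.normSq_apply, h2]; ring
    rw [ofReal_re, pow_two, Complex.mul_re, h2] at h4
    rw [norm_mul] at h5
    have : ‖z‖ ^ 2 = 0 := by nlinarith
    simpa using this

/-- If all planar sections of a convex body are close to each other, they are close to ellipses. -/
theorem exists_near_disc {K : Set V} (hK : IsCompact K) (hc : Convex ℝ K) (h0 : 0 ∈ interior K)
    {φ : ℂ →L[ℝ] V} (hφ : Function.Injective φ) {e : V} (he : e ∉ range φ) {η : ℝ} (hη : 0 < η)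
    (h : ∀ ψ : ℂ →L[ℝ] V, Function.Injective ψ → ∃ (A : ℂ ≃ₗ[ℝ] ℂ) (v z : ℂ),
      φ ⁻¹' K ⊆ A '' (ψ ⁻¹' K) + {v} ∧ A '' (ψ ⁻¹' K) ⊆ (1 + η ^ 3) • (φ ⁻¹' K) + {z}) :
    ∃ (S : ℂ ≃ₗ[ℝ] ℂ) (v : ℂ) (r : ℝ), 0 < r ∧ closedBall v r ⊆ S ⁻¹' (φ ⁻¹' K) ∧
      S ⁻¹' (φ ⁻¹' K) ⊆ closedBall v ((1 + 16200 * η) * r) := by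
  have hb := isBody_preimage hK hc h0 hφ
  by_cases hηs : 810 * η ≤ 1 / 2
  · have hη3 : η ^ 3 ≤ 1 / 40 := by
      have : η ^ 3 ≤ (1 / 1620) ^ 3 := by gcongr; linarith
      exact this.trans (by norm_num)
    have hiso := hb.isBody_isotropicPosition
    obtain ⟨v, r, hr, hs⟩ := hiso.exists_abs_supp_sub_le hη (by linarith) fun m m0 m1 m2 => by
      have hinj := sectionFamily_injective hφ he
      obtain ⟨w, hw⟩ := exists_circleCoeff_eq_zero hK hc h0 (continuous_sectionFamily φ e) hinj
        (fun w hw z => by rw [sectionFamily_one, sectionFamily_apply, hw]; simp) m0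
      obtain ⟨A, v, z, h1, h2⟩ := h _ (hinj w)
      exact norm_circleCoeff_isotropicPosition_le hb (isBody_preimage hK hc h0 (hinj w))
        (by positivity) hη3 h1 h2 m1 m2 hw
    have eS : (normEquiv _ hb).symm ⁻¹' (φ ⁻¹' K) = isotropicPosition (φ ⁻¹' K) :=
      ((normEquiv _ hb).toEquiv.image_eq_preimage_symm _).symm
    refine ⟨(normEquiv _ hb).symm, v, (1 - 810 * η) * r, mul_pos (by linarith) hr, ?_, ?_⟩
    · rw [eS]
      refine hiso.closedBall_subset_of_le_supp fun ξ hξ => ?_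
      linarith [(abs_le.1 (hs ξ hξ)).1]
    · rw [eS]
      refine (hiso.subset_closedBall_of_supp_le (R := (1 + 810 * η) * r) (by positivity)
        fun ξ hξ => ?_).trans (closedBall_subset_closedBall ?_)
      · linarith [(abs_le.1 (hs ξ hξ)).2]
      · rw [← mul_assoc]
        gcongr
        nlinarith
  · obtain ⟨S, v, r, hr, h1, h2⟩ := hb.exists_closedBall_subset
    refine ⟨S, v, r, hr, h1, h2.trans (closedBall_subset_closedBall ?_)⟩
    gcongr
    linarith

end SectionFamily

section BanachMazur

theorem dBMlt.preimage {V W V' W' : Type*} [AddCommGroup V] [Module ℝ V] [AddCommGroup W]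
    [Module ℝ W] [AddCommGroup V'] [Module ℝ V'] [AddCommGroup W'] [Module ℝ W']
    {K : Set V} {L : Set W} {lam : ℝ} (h : dBMlt K L lam) (f : V' ≃ₗ[ℝ] V) (g : W' ≃ₗ[ℝ] W) :
    dBMlt (f ⁻¹' K) (g ⁻¹' L) lam := by
  obtain ⟨T, z, h1, h2⟩ := h
  have e : (g.toAffineEquiv.trans (T.trans f.symm.toAffineEquiv)) '' (g ⁻¹' L) =
      f ⁻¹' (T '' L) := by
    ext x
    simp only [mem_image, mem_preimage, AffineEquiv.trans_apply, LinearEquiv.coe_toAffineEquiv,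
      LinearEquiv.symm_apply_eq]
    constructor
    · rintro ⟨y, hy, h⟩; exact ⟨g y, hy, h⟩
    · rintro ⟨y, hy, h⟩; exact ⟨g.symm y, by simpa using hy, by simpa using h⟩
  refine ⟨g.toAffineEquiv.trans (T.trans f.symm.toAffineEquiv), f.symm z, ?_, ?_⟩
  · rw [e]; exact preimage_mono h1
  · rw [e]
    intro x hx
    obtain ⟨_, ⟨y, hy, rfl⟩, _, rfl, hxy⟩ := h2 hx
    refine ⟨_, ⟨f.symm y, by simpa using hy, rfl⟩, _, rfl, f.injective ?_⟩
    simpa using hxy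

theorem dBMlt.exists_linearEquiv {V W : Type*} [AddCommGroup V] [Module ℝ V] [AddCommGroup W]
    [Module ℝ W] {K : Set V} {L : Set W} {lam : ℝ} (h : dBMlt K L lam) :
    ∃ (A : W ≃ₗ[ℝ] V) (v z : V), K ⊆ A '' L + {v} ∧ A '' L ⊆ lam • K + {z} := by
  obtain ⟨T, z, h1, h2⟩ := h
  have hT : ∀ x, T x = T.linear x + T 0 := fun x => by
    simpa using T.map_vadd 0 x
  refine ⟨T.linear, T 0, z - T 0, fun x hx => ?_, ?_⟩
  · obtain ⟨y, hy, rfl⟩ := h1 hx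
    exact ⟨_, mem_image_of_mem _ hy, _, rfl, (hT y).symm⟩
  · rintro _ ⟨y, hy, rfl⟩
    obtain ⟨x, hx, w, hw, hxy⟩ := h2 (mem_image_of_mem T hy)
    obtain rfl : w = z := hw
    refine ⟨x, hx, _, rfl, ?_⟩
    have hxy : x + w = T y := hxy
    change x + (w - T 0) = T.linear y
    rw [← add_sub_assoc, hxy, hT]
    simp

theorem dBMlt_closedBall {K : Set ℂ} {v : ℂ} {r lam : ℝ} (hr : 0 < r) (hlam : 0 < lam)
    (h1 : closedBall v r ⊆ K) (h2 : K ⊆ closedBall v (lam * r)) :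
    dBMlt K (closedBall (0 : EuclideanSpace ℝ (Fin 2)) 1) lam := by
  have hlr : 0 < lam * r := mul_pos hlam hr
  let ι : EuclideanSpace ℝ (Fin 2) ≃ₗᵢ[ℝ] ℂ := Complex.orthonormalBasisOneI.repr.symm
  let T : EuclideanSpace ℝ (Fin 2) ≃ᵃ[ℝ] ℂ :=
    (ι.toLinearEquiv.trans (LinearEquiv.smulOfNeZero ℝ ℂ (lam * r) hlr.ne')).toAffineEquiv.trans
      (AffineEquiv.constVAdd ℝ ℂ v)
  have hT : ∀ x, T x = v + (lam * r) • ι x := fun x => rfl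
  refine ⟨T, (1 - lam) • v, fun x hx => ?_, ?_⟩
  · refine ⟨ι.symm ((lam * r)⁻¹ • (x - v)), ?_, ?_⟩
    · rw [mem_closedBall_zero_iff, LinearIsometryEquiv.norm_map, norm_smul, norm_inv,
        Real.norm_of_nonneg hlr.le, inv_mul_le_iff₀ hlr, mul_one]
      exact mem_closedBall_iff_norm.1 (h2 hx)
    · rw [hT, LinearIsometryEquiv.apply_symm_apply, smul_smul, mul_inv_cancel₀ hlr.ne', one_smul]
      simp
  · rintro _ ⟨x, hx, rfl⟩
    refine ⟨_, ⟨v + r • ι x, h1 ?_, rfl⟩, _, rfl, ?_⟩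
    · rw [mem_closedBall_iff_norm, add_sub_cancel_left, norm_smul, LinearIsometryEquiv.norm_map,
        Real.norm_of_nonneg hr.le]
      exact mul_le_of_le_one_right hr.le (mem_closedBall_zero_iff.1 hx)
    · rw [hT]
      simp only [smul_add, sub_smul, one_smul, smul_smul]
      abel

end BanachMazur

theorem stmt14 :
    ∃ c : ℝ, 0 < c ∧
      ∀ (n : ℕ), 3 ≤ n →
        ∀ K : Set (EuclideanSpace ℝ (Fin n)),
          IsCompact K → Convex ℝ K → 0 ∈ interior K →
            ∀ δ : ℝ, 0 < δ →
              (∀ E F : Submodule ℝ (EuclideanSpace ℝ (Fin n)),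
                Module.finrank ℝ E = 2 → Module.finrank ℝ F = 2 →
                dBMlt (Subtype.val ⁻¹' K : Set E) (Subtype.val ⁻¹' K : Set F) (1 + δ)) →
              ∀ E : Submodule ℝ (EuclideanSpace ℝ (Fin n)), Module.finrank ℝ E = 2 →
                dBMlt (Subtype.val ⁻¹' K : Set E)
                  (closedBall (0 : EuclideanSpace ℝ (Fin 2)) 1)
                  (1 + c * δ ^ ((1 : ℝ) / 3)) := by
  refine ⟨16200, by norm_num, fun n hn K hK hc h0 δ hδ h E hE => ?_⟩
  set η := δ ^ ((1 : ℝ) / 3) with hη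
  have hη0 : 0 < η := Real.rpow_pos_of_pos hδ _
  have hη3 : η ^ 3 = δ := by
    rw [hη, ← Real.rpow_natCast, ← Real.rpow_mul hδ.le]
    norm_num
  obtain ⟨e, he⟩ : ∃ e, e ∉ E := by
    by_contra! hall
    have : E = ⊤ := (Submodule.eq_top_iff').2 hall
    rw [this, finrank_top, finrank_euclideanSpace_fin] at hE
    omega
  let f : ℂ ≃ₗ[ℝ] E := LinearEquiv.ofFinrankEq _ _ (by rw [hE, Complex.finrank_real_complex])
  let φ : ℂ →L[ℝ] EuclideanSpace ℝ (Fin n) :=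
    LinearMap.toContinuousLinearMap (E.subtype ∘ₗ (f : ℂ →ₗ[ℝ] E))
  have hφ : Function.Injective φ := E.injective_subtype.comp f.injective
  have heφ : e ∉ range φ := by
    rintro ⟨z, rfl⟩
    exact he (f z).2
  obtain ⟨S, v, r, hr, h1, h2⟩ := exists_near_disc hK hc h0 hφ heφ hη0 fun ψ hψ => by
    let g : ℂ ≃ₗ[ℝ] LinearMap.range (ψ : ℂ →ₗ[ℝ] EuclideanSpace ℝ (Fin n)) :=
      LinearEquiv.ofInjective _ hψ
    have hF : Module.finrank ℝ (LinearMap.range (ψ : ℂ →ₗ[ℝ] EuclideanSpace ℝ (Fin n))) = 2 := by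
      rw [← g.finrank_eq, Complex.finrank_real_complex]
    rw [hη3]
    exact ((h E _ hE hF).preimage f g).exists_linearEquiv
  have := (dBMlt_closedBall hr (by positivity) h1 h2).preimage (f.symm.trans S.symm)
    (LinearEquiv.refl ℝ (EuclideanSpace ℝ (Fin 2)))
  have e : (f.symm.trans S.symm) ⁻¹' (S ⁻¹' (φ ⁻¹' K)) = (Subtype.val ⁻¹' K : Set E) := by
    ext x
    simp [φ]
  rw [e] at this
  exact this
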